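/- arXiv:1503.03286 — 4 statements merged into one kernel-verified Lean document; each statement's English description precedes it below -/
import Mathlib

section
/- Let ξ be a joining of two shift-invariant Borel probability measures μ and ν on K^ℕ, and let x ∈ K^ℕ be a point generic for μ. Then there exists a point y ∈ K^ℕ such that the pair (x,y) ∈ (K×K)^ℕ is generic for ξ (in particular, y is generic for ν). -/
open MeasureTheory Filter Topology

noncomputable section

/-- The shift map on complex-valued sequences. -/
def shift : (ℕ → ℂ) → (ℕ → ℂ) := fun x n => x (n + 1)

/-- The product shift on pairs of sequences. -/
def shift2 : (ℕ → ℂ) × (ℕ → ℂ) → (ℕ → ℂ) × (ℕ → ℂ) := fun p => (shift p.1, shift p.2)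

/-- Shift-invariant Borel probability measure. -/
def InvariantProb (μ : Measure (ℕ → ℂ)) : Prop :=
  IsProbabilityMeasure μ ∧ MeasurePreserving shift μ μ

/-- `μ` is a measure on `K^ℕ`: it gives full mass to sequences with values in `K`. -/
def SupportedOn (μ : Measure (ℕ → ℂ)) (K : Set ℂ) : Prop := μ {z | ∀ n, z n ∈ K} = 1

/-- A joining of `μ` and `ν`. -/
def IsJoining (ξ : Measure ((ℕ → ℂ) × (ℕ → ℂ))) (μ ν : Measure (ℕ → ℂ)) : Prop :=
  IsProbabilityMeasure ξ ∧ MeasurePreserving shift2 ξ ξ ∧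
    ξ.map Prod.fst = μ ∧ ξ.map Prod.snd = ν

/-- A point is generic for a shift-invariant measure. -/
def IsGeneric (x : ℕ → ℂ) (μ : Measure (ℕ → ℂ)) : Prop :=
  ∀ f : C((ℕ → ℂ), ℂ),
    Tendsto (fun n : ℕ => (n : ℂ)⁻¹ * ∑ i ∈ Finset.range n, f (shift^[i + 1] x))
      atTop (𝓝 (∫ z, f z ∂μ))

/-- A pair of points is generic for a measure on the product symbolic space. -/
def IsGeneric2 (p : (ℕ → ℂ) × (ℕ → ℂ)) (ξ : Measure ((ℕ → ℂ) × (ℕ → ℂ))) : Prop :=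
  ∀ f : C((ℕ → ℂ) × (ℕ → ℂ), ℂ),
    Tendsto (fun n : ℕ => (n : ℂ)⁻¹ * ∑ i ∈ Finset.range n, f (shift2^[i + 1] p))
      atTop (𝓝 (∫ q, f q ∂ξ))


/-- The sequences with values in `K`. -/
def seqIn (K : Set ℂ) : Set (ℕ → ℂ) := {z | ∀ n, z n ∈ K}

/-- `f (z, w)` depends on `w` only through its first `l` coordinates. -/
def DependsOnFirst (l : ℕ) (f : (ℕ → ℂ) × (ℕ → ℂ) → ℝ) : Prop :=
  ∀ z w w' : ℕ → ℂ, (∀ i < l, w i = w' i) → f (z, w) = f (z, w')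

lemma shift_iterate_apply (t : ℕ) (x : ℕ → ℂ) (n : ℕ) : shift^[t] x n = x (n + t) := by
  induction t generalizing x with
  | zero => rfl
  | succ t ih => rw [Function.iterate_succ_apply, ih]; simp [shift, add_assoc]

lemma shift_iterate_add (s t : ℕ) (x : ℕ → ℂ) : shift^[s] (shift^[t] x) = shift^[s + t] x :=
  (Function.iterate_add_apply shift s t x).symm

lemma shift2_iterate (t : ℕ) (p : (ℕ → ℂ) × (ℕ → ℂ)) :
    shift2^[t] p = (shift^[t] p.1, shift^[t] p.2) := by
  induction t generalizing p with
  | zero => rfl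
  | succ t ih => rw [Function.iterate_succ_apply, ih]; rfl

lemma continuous_shift : Continuous shift := by
  unfold shift; fun_prop

lemma continuous_shift_iterate (t : ℕ) : Continuous (shift^[t]) :=
  continuous_shift.iterate t

lemma shift_iterate_mem {K : Set ℂ} {x : ℕ → ℂ} (hx : x ∈ seqIn K) (t : ℕ) :
    shift^[t] x ∈ seqIn K := fun n => by
  rw [shift_iterate_apply]; exact hx _

lemma isCompact_seqIn {K : Set ℂ} (hK : IsCompact K) : IsCompact (seqIn K) := by
  have : seqIn K = Set.pi Set.univ (fun _ : ℕ => K) := by ext; simp [seqIn]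
  rw [this]; exact isCompact_univ_pi fun _ => hK

/-- A lower bound for averages over windows `[a, a + a / c + 1)`. -/
lemma eventually_window_sum_ge {u : ℕ → ℝ} {m : ℝ}
    (hu : Tendsto (fun n : ℕ => (n : ℝ)⁻¹ * ∑ i ∈ Finset.range n, u i) atTop (𝓝 m))
    (hm : 0 ≤ m) {c : ℕ} (hc : 0 < c) {δ : ℝ} (hδ : 0 < δ) :
    ∀ᶠ a : ℕ in atTop,
      -(δ * ((a / c + 1 : ℕ) : ℝ)) ≤ ∑ t ∈ Finset.Ico a (a + (a / c + 1)), u t := by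
  have hη : 0 < δ / (2 * c + 1) := by positivity
  obtain ⟨n0, hn0⟩ := (Metric.tendsto_atTop.1 hu) _ hη
  have key : ∀ n ≥ n0, 0 < n → |∑ i ∈ Finset.range n, u i - n * m| ≤ δ / (2 * c + 1) * n := by
    intro n hn hpos
    have hp : (0 : ℝ) < n := by exact_mod_cast hpos
    have h := (hn0 n hn).le
    rw [Real.dist_eq] at h
    have e : ∑ i ∈ Finset.range n, u i - n * m
        = n * ((n : ℝ)⁻¹ * ∑ i ∈ Finset.range n, u i - m) := by
      field_simp
    rw [e, abs_mul, abs_of_pos hp, mul_comm]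
    exact mul_le_mul_of_nonneg_right h hp.le
  filter_upwards [eventually_ge_atTop (n0 + 1)] with a ha
  have h0 := Nat.zero_le (a / c)
  have h1 := abs_le.1 (key a (by omega) (by omega))
  have h2 := abs_le.1 (key (a + (a / c + 1)) (by omega) (by omega))
  rw [Finset.sum_Ico_eq_sub _ (Nat.le_add_right _ _)]
  have h3 : (a : ℝ) ≤ c * ((a / c + 1 : ℕ) : ℝ) := by
    exact_mod_cast (Nat.lt_mul_div_succ a hc).le
  rw [Nat.cast_add a] at h2
  set L : ℝ := ((a / c + 1 : ℕ) : ℝ)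
  have hL : 0 ≤ L := Nat.cast_nonneg _
  set η := δ / (2 * c + 1)
  have e : δ = η * (2 * c + 1) := by simp only [η]; field_simp
  rw [e]
  have : η * a ≤ η * (c * L) := by gcongr
  nlinarith [mul_nonneg hL hm]

/-- The largest value over `w ∈ K^ℕ` of the Birkhoff sum of length `N` of `∑ j, θ j * f j`
along `(z, w)`. -/
def maxSum {ι : Type*} [Fintype ι] (K : Set ℂ) (f : ι → (ℕ → ℂ) × (ℕ → ℂ) → ℝ) (N : ℕ)
    (θ : ι → ℝ) (z : ℕ → ℂ) : ℝ :=
  sSup ((fun w => ∑ t ∈ Finset.range N, ∑ j, θ j * f j (shift^[t] z, shift^[t] w)) '' seqIn K)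

section MaxSum

variable {ι : Type*} [Fintype ι] {K : Set ℂ} {f : ι → (ℕ → ℂ) × (ℕ → ℂ) → ℝ}

lemma continuous_sum_shift (hf : ∀ j, Continuous (f j)) (s : Finset ℕ) (θ : ι → ℝ) :
    Continuous fun p : (ℕ → ℂ) × (ℕ → ℂ) =>
      ∑ t ∈ s, ∑ j, θ j * f j (shift^[t] p.1, shift^[t] p.2) := by
  refine continuous_finsetSum _ fun t _ => continuous_finsetSum _ fun j _ => ?_
  exact continuous_const.mul ((hf j).comp
    (((continuous_shift_iterate t).comp continuous_fst).prodMk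
      ((continuous_shift_iterate t).comp continuous_snd)))

lemma continuous_maxSum (hK : IsCompact K) (hf : ∀ j, Continuous (f j)) (N : ℕ) (θ : ι → ℝ) :
    Continuous (maxSum K f N θ) :=
  (isCompact_seqIn hK).continuous_sSup (f := fun z w =>
    ∑ t ∈ Finset.range N, ∑ j, θ j * f j (shift^[t] z, shift^[t] w))
    (continuous_sum_shift hf (Finset.range N) θ)

lemma le_maxSum (hK : IsCompact K) (hf : ∀ j, Continuous (f j)) (N : ℕ) (θ : ι → ℝ)
    (z : ℕ → ℂ) {w : ℕ → ℂ} (hw : w ∈ seqIn K) :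
    ∑ t ∈ Finset.range N, ∑ j, θ j * f j (shift^[t] z, shift^[t] w) ≤ maxSum K f N θ z := by
  refine le_csSup ?_ ⟨w, hw, rfl⟩
  refine ((isCompact_seqIn hK).image ?_).bddAbove
  exact (continuous_sum_shift hf (Finset.range N) θ).comp (Continuous.prodMk_right z)

lemma exists_eq_maxSum (hK : IsCompact K) (hne : K.Nonempty) (hf : ∀ j, Continuous (f j)) (N : ℕ)
    (θ : ι → ℝ) (z : ℕ → ℂ) :
    ∃ w ∈ seqIn K,
      ∑ t ∈ Finset.range N, ∑ j, θ j * f j (shift^[t] z, shift^[t] w) = maxSum K f N θ z := by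
  obtain ⟨k, hk⟩ := hne
  have hc : Continuous fun w : ℕ → ℂ =>
      ∑ t ∈ Finset.range N, ∑ j, θ j * f j (shift^[t] z, shift^[t] w) :=
    (continuous_sum_shift hf (Finset.range N) θ).comp (Continuous.prodMk_right z)
  obtain ⟨w, hw, h, -⟩ := (isCompact_seqIn hK).exists_sSup_image_eq_and_ge
    ⟨fun _ => k, fun _ => hk⟩ hc.continuousOn
  exact ⟨w, hw, h.symm⟩

lemma abs_combination_le {C : ℝ} {p : (ℕ → ℂ) × (ℕ → ℂ)} (hp : p.1 ∈ seqIn K ∧ p.2 ∈ seqIn K)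
    (hC : ∀ j, ∀ z ∈ seqIn K, ∀ w ∈ seqIn K, |f j (z, w)| ≤ C) {θ : ι → ℝ} {r : ℝ}
    (hθ : ∀ j, |θ j| ≤ r) : |∑ j, θ j * f j p| ≤ Fintype.card ι * (r * C) := by
  refine (Finset.abs_sum_le_sum_abs _ _).trans ?_
  refine (Finset.sum_le_card_nsmul _ _ (r * C) fun j _ => ?_).trans (by simp)
  rw [abs_mul]
  exact mul_le_mul (hθ j) (hC j _ hp.1 _ hp.2) (abs_nonneg _) ((abs_nonneg _).trans (hθ j))

lemma maxSum_le_add (hK : IsCompact K) (hne : K.Nonempty) (hf : ∀ j, Continuous (f j)) {C : ℝ}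
    (hC : ∀ j, ∀ z ∈ seqIn K, ∀ w ∈ seqIn K, |f j (z, w)| ≤ C) (N : ℕ) {θ η : ι → ℝ} {r : ℝ}
    (hθ : ∀ j, |θ j - η j| ≤ r) {z : ℕ → ℂ} (hz : z ∈ seqIn K) :
    maxSum K f N θ z ≤ maxSum K f N η z + N * (Fintype.card ι * (r * C)) := by
  obtain ⟨w, hw, h⟩ := exists_eq_maxSum hK hne hf N θ z
  have h1 := le_maxSum hK hf N η z hw
  have h2 : ∑ t ∈ Finset.range N, ∑ j, θ j * f j (shift^[t] z, shift^[t] w)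
      - ∑ t ∈ Finset.range N, ∑ j, η j * f j (shift^[t] z, shift^[t] w)
      ≤ N * (Fintype.card ι * (r * C)) := by
    rw [← Finset.sum_sub_distrib]
    refine (Finset.sum_le_card_nsmul _ _ (Fintype.card ι * (r * C)) fun t _ => ?_).trans (by simp)
    rw [← Finset.sum_sub_distrib]
    refine (le_abs_self _).trans ?_
    simp only [← sub_mul]
    exact abs_combination_le ⟨shift_iterate_mem hz t, shift_iterate_mem hw t⟩ hC hθ
  linarith

lemma maxSum_le (hK : IsCompact K) (hne : K.Nonempty) (hf : ∀ j, Continuous (f j)) {C : ℝ}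
    (hC : ∀ j, ∀ z ∈ seqIn K, ∀ w ∈ seqIn K, |f j (z, w)| ≤ C) (N : ℕ) {θ : ι → ℝ} {r : ℝ}
    (hθ : ∀ j, |θ j| ≤ r) {z : ℕ → ℂ} (hz : z ∈ seqIn K) :
    maxSum K f N θ z ≤ N * (Fintype.card ι * (r * C)) := by
  obtain ⟨w, hw, h⟩ := exists_eq_maxSum hK hne hf N θ z
  rw [← h]
  refine (Finset.sum_le_card_nsmul _ _ (Fintype.card ι * (r * C)) fun t _ => ?_).trans (by simp)
  exact (le_abs_self _).trans
    (abs_combination_le ⟨shift_iterate_mem hz t, shift_iterate_mem hw t⟩ hC hθ)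

lemma integrable_of_continuous_of_ae_mem {α E : Type*} [TopologicalSpace α] [MeasurableSpace α]
    [OpensMeasurableSpace α] [NormedAddCommGroup E] [SecondCountableTopology E]
    {ξ : Measure α} [IsFiniteMeasure ξ] {s : Set α} (hs : IsCompact s) (h : ∀ᵐ p ∂ξ, p ∈ s)
    {g : α → E} (hg : Continuous g) : Integrable g ξ := by
  borelize E
  obtain ⟨C, hC⟩ := hs.exists_bound_of_continuousOn hg.continuousOn
  exact Integrable.of_bound hg.measurable.aestronglyMeasurable C (h.mono hC)

/-- A joining gives `maxSum` a nonnegative mean as soon as each `f j` has mean zero. -/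
lemma integral_maxSum_nonneg (hK : IsCompact K) (hf : ∀ j, Continuous (f j))
    {ξ : Measure ((ℕ → ℂ) × (ℕ → ℂ))} [IsProbabilityMeasure ξ] (hinv : MeasurePreserving shift2 ξ ξ)
    (hsupp : ∀ᵐ p ∂ξ, p ∈ seqIn K ×ˢ seqIn K) (h0 : ∀ j, ∫ p, f j p ∂ξ = 0) (N : ℕ) (θ : ι → ℝ) :
    0 ≤ ∫ z, maxSum K f N θ z ∂(ξ.map Prod.fst) := by
  have hcomp := (isCompact_seqIn hK).prod (isCompact_seqIn hK)
  have hM := continuous_maxSum hK hf N θ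
  rw [integral_map measurable_fst.aemeasurable hM.measurable.aestronglyMeasurable]
  have hterm : ∀ (t : ℕ) (j : ι), Continuous fun p : (ℕ → ℂ) × (ℕ → ℂ) =>
      θ j * f j (shift^[t] p.1, shift^[t] p.2) := fun t j =>
    continuous_const.mul ((hf j).comp (((continuous_shift_iterate t).comp continuous_fst).prodMk
      ((continuous_shift_iterate t).comp continuous_snd)))
  have hzero : ∫ p : (ℕ → ℂ) × (ℕ → ℂ),
      ∑ t ∈ Finset.range N, ∑ j, θ j * f j (shift^[t] p.1, shift^[t] p.2) ∂ξ = 0 := by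
    rw [integral_finsetSum _ fun t _ => integrable_finsetSum _ fun j _ =>
      integrable_of_continuous_of_ae_mem hcomp hsupp (hterm t j)]
    refine Finset.sum_eq_zero fun t _ => ?_
    rw [integral_finsetSum _ fun j _ =>
      integrable_of_continuous_of_ae_mem hcomp hsupp (hterm t j)]
    refine Finset.sum_eq_zero fun j _ => ?_
    have hp := hinv.iterate t
    have : ∫ p, f j (shift2^[t] p) ∂ξ = 0 := by
      rw [← h0 j]
      conv_rhs => rw [← hp.map_eq]
      rw [integral_map hp.measurable.aemeasurable (hf j).measurable.aestronglyMeasurable]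
    simp only [shift2_iterate] at this
    rw [integral_const_mul, this, mul_zero]
  rw [← hzero]
  refine integral_mono_ae (integrable_of_continuous_of_ae_mem hcomp hsupp
    (continuous_sum_shift hf (Finset.range N) θ))
    (integrable_of_continuous_of_ae_mem hcomp hsupp (hM.comp continuous_fst)) ?_
  filter_upwards [hsupp] with p hp
  exact le_maxSum hK hf N θ p.1 hp.2

/-- Uniformly in the direction `θ`, window averages of `maxSum` are almost nonnegative. -/
lemma eventually_window_maxSum_ge (hK : IsCompact K) (hne : K.Nonempty)
    (hf : ∀ j, Continuous (f j)) {C : ℝ}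
    (hC : ∀ j, ∀ z ∈ seqIn K, ∀ w ∈ seqIn K, |f j (z, w)| ≤ C)
    {ξ : Measure ((ℕ → ℂ) × (ℕ → ℂ))} [IsProbabilityMeasure ξ] (hinv : MeasurePreserving shift2 ξ ξ)
    (hsupp : ∀ᵐ p ∂ξ, p ∈ seqIn K ×ˢ seqIn K) (h0 : ∀ j, ∫ p, f j p ∂ξ = 0)
    {x : ℕ → ℂ} (hx : x ∈ seqIn K)
    (hgen : ∀ g : (ℕ → ℂ) → ℝ, Continuous g →
      Tendsto (fun n : ℕ => (n : ℝ)⁻¹ * ∑ i ∈ Finset.range n, g (shift^[i] x)) atTop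
        (𝓝 (∫ z, g z ∂(ξ.map Prod.fst))))
    {c : ℕ} (hc : 0 < c) (N : ℕ) :
    ∀ᶠ a : ℕ in atTop, ∀ θ ∈ Set.Icc (-1 : ι → ℝ) 1,
      -((a / c + 1 : ℕ) : ℝ) ≤
        ∑ t ∈ Finset.Ico a (a + (a / c + 1)), maxSum K f N θ (shift^[t] x) := by
  have hC0 : 0 ≤ |C| := abs_nonneg C
  have hC' : ∀ j, ∀ z ∈ seqIn K, ∀ w ∈ seqIn K, |f j (z, w)| ≤ |C| :=
    fun j z hz w hw => (hC j z hz w hw).trans (le_abs_self C)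
  refine isCompact_Icc.induction_on (p := fun s => ∀ᶠ a : ℕ in atTop, ∀ θ ∈ s,
    -((a / c + 1 : ℕ) : ℝ) ≤
        ∑ t ∈ Finset.Ico a (a + (a / c + 1)), maxSum K f N θ (shift^[t] x)) ?_ ?_ ?_ ?_
  · simp
  · intro s t hst h
    exact h.mono fun a ha θ hθ => ha θ (hst hθ)
  · intro s t hs ht
    filter_upwards [hs, ht] with a h1 h2 θ hθ
    exact hθ.elim (h1 θ) (h2 θ)
  · intro η _
    set r : ℝ := 1 / (2 * (N * (Fintype.card ι * |C|) + 1)) with hr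
    have hr0 : 0 < r := by positivity
    refine ⟨Metric.closedBall η r, mem_nhdsWithin_of_mem_nhds (Metric.closedBall_mem_nhds η hr0), ?_⟩
    have hev := eventually_window_sum_ge (hgen _ (continuous_maxSum hK hf N η))
      (integral_maxSum_nonneg hK hf hinv hsupp h0 N η) hc (δ := 1 / 2) (by norm_num)
    filter_upwards [hev] with a ha θ hθ
    have hsmall : N * (Fintype.card ι * (r * |C|)) ≤ (1 / 2 : ℝ) := by
      have : N * (Fintype.card ι * (r * |C|)) = r * (N * (Fintype.card ι * |C|)) := by ring
      rw [this, hr, div_mul_eq_mul_div, div_le_div_iff₀ (by positivity) (by norm_num)]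
      linarith
    have hle : ∀ t ∈ Finset.Ico a (a + (a / c + 1)),
        maxSum K f N η (shift^[t] x) - 1 / 2 ≤ maxSum K f N θ (shift^[t] x) := by
      intro t _
      have := maxSum_le_add hK hne hf hC' N (θ := η) (η := θ) (r := r) (fun j => by
        rw [abs_sub_comm, ← Real.dist_eq]
        exact (dist_le_pi_dist θ η j).trans hθ) (shift_iterate_mem hx t)
      linarith
    have hsum := Finset.sum_le_sum hle
    rw [Finset.sum_sub_distrib] at hsum
    simp only [Finset.sum_const, Nat.card_Ico, nsmul_eq_mul, add_tsub_cancel_left] at hsum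
    linarith

end MaxSum

lemma abs_sum_le_card_mul {s T : Finset ℕ} {u : ℕ → ℝ} {B : ℝ} (hB : 0 ≤ B)
    (hu : ∀ t ∈ s, |u t| ≤ B) (h0 : ∀ t ∈ s, t ∉ T → u t = 0) : |∑ t ∈ s, u t| ≤ T.card * B := by
  rw [← Finset.sum_filter_add_sum_filter_not s (· ∈ T),
    Finset.sum_eq_zero (s := s.filter (· ∉ T)) fun t ht => h0 t (Finset.mem_filter.1 ht).1
      (Finset.mem_filter.1 ht).2, add_zero]
  refine (Finset.abs_sum_le_sum_abs _ _).trans ?_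
  refine (Finset.sum_le_card_nsmul _ _ B fun t ht => hu t (Finset.mem_filter.1 ht).1).trans ?_
  rw [nsmul_eq_mul]
  refine mul_le_mul_of_nonneg_right ?_ hB
  exact_mod_cast Finset.card_le_card fun t ht => (Finset.mem_filter.1 ht).2

/-- The sequence `y` with the block at positions `[i, i + N)` replaced by the first `N` terms
of `v`. -/
def splice (y v : ℕ → ℂ) (i N : ℕ) : ℕ → ℂ :=
  fun n => if i ≤ n ∧ n < i + N then v (n - i) else y n

lemma splice_mem {K : Set ℂ} {y v : ℕ → ℂ} (hy : y ∈ seqIn K) (hv : v ∈ seqIn K) (i N : ℕ) :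
    splice y v i N ∈ seqIn K := fun n => by
  unfold splice; split_ifs
  · exact hv _
  · exact hy _

section Exchange

variable {f : (ℕ → ℂ) × (ℕ → ℂ) → ℝ} {l : ℕ}

lemma DependsOnFirst.splice_eq_left (hf : DependsOnFirst l f) (z y v : ℕ → ℂ) {i N t : ℕ}
    (ht : t + l ≤ i ∨ i + N ≤ t) : f (z, shift^[t] (splice y v i N)) = f (z, shift^[t] y) := by
  refine hf _ _ _ fun n hn => ?_
  rw [shift_iterate_apply, shift_iterate_apply, splice, if_neg (by omega)]

lemma DependsOnFirst.splice_eq_right (hf : DependsOnFirst l f) (z y v : ℕ → ℂ) {i N t : ℕ}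
    (hit : i ≤ t) (ht : t + l ≤ i + N) :
    f (z, shift^[t] (splice y v i N)) = f (z, shift^[t - i] v) := by
  refine hf _ _ _ fun n hn => ?_
  rw [shift_iterate_apply, shift_iterate_apply, splice, if_pos (by omega),
    Nat.add_sub_assoc hit]

variable {K : Set ℂ} {C : ℝ}

/-- Replacing a block changes a Birkhoff sum by the corresponding change on that block, up to
boundary terms. -/
lemma DependsOnFirst.abs_sum_splice_sub_le (hf : DependsOnFirst l f) (hC0 : 0 ≤ C)
    (hC : ∀ z ∈ seqIn K, ∀ w ∈ seqIn K, |f (z, w)| ≤ C) {x y v : ℕ → ℂ} (hx : x ∈ seqIn K)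
    (hy : y ∈ seqIn K) (hv : v ∈ seqIn K) {a b i N : ℕ} (hai : a ≤ i) (hib : i + N ≤ b) :
    |∑ t ∈ Finset.Ico a b, f (shift^[t] x, shift^[t] (splice y v i N))
      - ∑ t ∈ Finset.Ico a b, f (shift^[t] x, shift^[t] y)
      - (∑ t ∈ Finset.range N, f (shift^[t] (shift^[i] x), shift^[t] v)
        - ∑ t ∈ Finset.range N, f (shift^[i + t] x, shift^[i + t] y))| ≤ 4 * C * l := by
  have hbd : ∀ t s, ∀ w ∈ seqIn K, ∀ w' ∈ seqIn K,
      |f (shift^[t] x, shift^[t] w) - f (shift^[t] x, shift^[s] w')| ≤ 2 * C := by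
    intro t s w hw w' hw'
    have h1 := hC _ (shift_iterate_mem hx t) _ (shift_iterate_mem hw t)
    have h2 := hC _ (shift_iterate_mem hx t) _ (shift_iterate_mem hw' s)
    exact (abs_sub _ _).trans (by linarith)
  have hs := splice_mem hy hv i N
  have e1 : ∑ t ∈ Finset.range N, f (shift^[t] (shift^[i] x), shift^[t] v)
      = ∑ t ∈ Finset.Ico i (i + N), f (shift^[t] x, shift^[t - i] v) := by
    rw [Finset.sum_Ico_eq_sum_range]
    simp only [add_tsub_cancel_left, shift_iterate_add, add_comm _ i]
  have e2 : ∑ t ∈ Finset.range N, f (shift^[i + t] x, shift^[i + t] y)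
      = ∑ t ∈ Finset.Ico i (i + N), f (shift^[t] x, shift^[t] y) := by
    rw [Finset.sum_Ico_eq_sum_range]
    simp only [add_tsub_cancel_left]
  have e3 : ∀ u : ℕ → ℝ, ∑ t ∈ Finset.Ico a b, u t = ∑ t ∈ Finset.Ico a i, u t
      + ∑ t ∈ Finset.Ico i (i + N), u t + ∑ t ∈ Finset.Ico (i + N) b, u t := by
    intro u
    rw [Finset.sum_Ico_consecutive _ hai (Nat.le_add_right _ _),
      Finset.sum_Ico_consecutive _ (by omega) hib]
  have e4 : ∑ t ∈ Finset.Ico (i + N) b, f (shift^[t] x, shift^[t] (splice y v i N))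
      = ∑ t ∈ Finset.Ico (i + N) b, f (shift^[t] x, shift^[t] y) :=
    Finset.sum_congr rfl fun t ht =>
      hf.splice_eq_left _ _ _ (Or.inr (Finset.mem_Ico.1 ht).1)
  rw [e1, e2, e3, e3 (fun t => f (shift^[t] x, shift^[t] y)), e4]
  have h1 : |∑ t ∈ Finset.Ico a i, (f (shift^[t] x, shift^[t] (splice y v i N))
      - f (shift^[t] x, shift^[t] y))| ≤ (Finset.Ico (i - l) i).card * (2 * C) := by
    refine abs_sum_le_card_mul (by linarith) (fun t _ => hbd t t _ hs _ hy) fun t ht hT => ?_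
    rw [Finset.mem_Ico] at ht hT
    rw [hf.splice_eq_left _ _ _ (Or.inl (by omega)), sub_self]
  have h2 : |∑ t ∈ Finset.Ico i (i + N), (f (shift^[t] x, shift^[t] (splice y v i N))
      - f (shift^[t] x, shift^[t - i] v))|
      ≤ (Finset.Ico (i + N - l) (i + N)).card * (2 * C) := by
    refine abs_sum_le_card_mul (by linarith) (fun t _ => hbd t _ _ hs _ hv) fun t ht hT => ?_
    rw [Finset.mem_Ico] at ht hT
    rw [hf.splice_eq_right _ _ _ ht.1 (by omega), sub_self]
  rw [Finset.sum_sub_distrib] at h1 h2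
  have c1 : ((Finset.Ico (i - l) i).card : ℝ) ≤ l := by
    rw [Nat.card_Ico]; exact_mod_cast (by omega)
  have c2 : ((Finset.Ico (i + N - l) (i + N)).card : ℝ) ≤ l := by
    rw [Nat.card_Ico]; exact_mod_cast (by omega)
  have h1' := h1.trans (mul_le_mul_of_nonneg_right c1 (by linarith))
  have h2' := h2.trans (mul_le_mul_of_nonneg_right c2 (by linarith))
  rw [abs_le] at *
  constructor <;> linarith

lemma DependsOnFirst.abs_sum_splice_sub_le_add (hf : DependsOnFirst l f) (hC0 : 0 ≤ C)
    (hC : ∀ z ∈ seqIn K, ∀ w ∈ seqIn K, |f (z, w)| ≤ C) {x y v : ℕ → ℂ} (hx : x ∈ seqIn K)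
    (hy : y ∈ seqIn K) (hv : v ∈ seqIn K) (a b i N : ℕ) :
    |∑ t ∈ Finset.Ico a b, f (shift^[t] x, shift^[t] (splice y v i N))
      - ∑ t ∈ Finset.Ico a b, f (shift^[t] x, shift^[t] y)| ≤ (l + N) * (2 * C) := by
  rw [← Finset.sum_sub_distrib]
  have : |∑ t ∈ Finset.Ico a b, (f (shift^[t] x, shift^[t] (splice y v i N))
      - f (shift^[t] x, shift^[t] y))| ≤ (Finset.Ico (i - l) (i + N)).card * (2 * C) := by
    refine abs_sum_le_card_mul (by linarith) (fun t _ => ?_) fun t ht hT => ?_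
    · have h1 := hC _ (shift_iterate_mem hx t) _ (shift_iterate_mem (splice_mem hy hv i N) t)
      have h2 := hC _ (shift_iterate_mem hx t) _ (shift_iterate_mem hy t)
      exact (abs_sub _ _).trans (by linarith)
    · rw [Finset.mem_Ico] at hT
      rw [hf.splice_eq_left _ _ _ (by omega), sub_self]
  refine this.trans (mul_le_mul_of_nonneg_right ?_ (by linarith))
  rw [Nat.card_Ico]; exact_mod_cast (by omega)

end Exchange

/-- Summing over all sub-blocks of length `N` counts almost every term `N` times. -/
lemma sum_block_sum_le {u : ℕ → ℝ} {D : ℝ} (hD : 0 ≤ D) (hu : ∀ t, |u t| ≤ D) {a b N : ℕ}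
    (hN : a + N ≤ b) :
    ∑ i ∈ Finset.Ico a (b - N), ∑ t ∈ Finset.range N, u (i + t)
      ≤ N * (∑ t ∈ Finset.Ico a b, u t + N * D) := by
  rw [Finset.sum_comm]
  refine (Finset.sum_le_card_nsmul _ _ (∑ t ∈ Finset.Ico a b, u t + N * D) fun s hs => ?_).trans
    (by simp [mul_add])
  rw [Finset.mem_range] at hs
  have hneg : ∀ p q : ℕ, p ≤ q → -(((q : ℝ) - p) * D) ≤ ∑ t ∈ Finset.Ico p q, u t := by
    intro p q hpq
    have := abs_sum_le_card_mul (T := Finset.Ico p q) hD (fun t _ => hu t)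
      (fun t ht hT => absurd ht hT)
    rw [Nat.card_Ico, Nat.cast_sub hpq] at this
    exact (abs_le.1 this).1
  have h1 := hneg a (a + s) (by omega)
  have h2 := hneg (b - N + s) b (by omega)
  rw [Finset.sum_Ico_add' u a (b - N) s,
    ← Finset.sum_Ico_consecutive u (show a ≤ a + s by omega) (show a + s ≤ b by omega),
    ← Finset.sum_Ico_consecutive u (show a + s ≤ b - N + s by omega)
      (show b - N + s ≤ b by omega)]
  rw [Nat.cast_add, Nat.cast_sub (by omega)] at h2
  push_cast at h1
  linarith

section Window

variable {ι : Type*} [Fintype ι] {K : Set ℂ} {f : ι → (ℕ → ℂ) × (ℕ → ℂ) → ℝ}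

/-- If `∑ j, (S j) ^ 2` does not decrease when `S` is changed by `Δ`, then the component of `Δ` in
the direction of `-S` is small. -/
lemma sum_neg_div_mul_le {S Δ : ι → ℝ} {R E : ℝ} (hR : 0 < R) (hΔ : ∀ j, |Δ j| ≤ E)
    (hmin : ∑ j, S j ^ 2 ≤ ∑ j, (S j + Δ j) ^ 2) :
    ∑ j, -S j / R * Δ j ≤ Fintype.card ι * E ^ 2 / (2 * R) := by
  have h1 : ∑ j, Δ j ^ 2 ≤ Fintype.card ι * E ^ 2 := by
    refine (Finset.sum_le_card_nsmul _ _ (E ^ 2) fun j _ => ?_).trans (by simp)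
    exact sq_le_sq' (abs_le.1 (hΔ j)).1 (abs_le.1 (hΔ j)).2
  have h2 : ∑ j, (S j + Δ j) ^ 2 = ∑ j, S j ^ 2 + 2 * ∑ j, S j * Δ j + ∑ j, Δ j ^ 2 := by
    rw [Finset.mul_sum, ← Finset.sum_add_distrib, ← Finset.sum_add_distrib]
    exact Finset.sum_congr rfl fun j _ => by ring
  have h3 : ∑ j, -S j / R * Δ j = (-∑ j, S j * Δ j) / R := by
    rw [← Finset.sum_neg_distrib, Finset.sum_div]
    exact Finset.sum_congr rfl fun j _ => by ring
  rw [h3, div_le_div_iff₀ hR (by positivity)]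
  nlinarith

/-- Every late window `[a, a + a / c + 1)` carries a word along which all `f j` have small
averages. -/
lemma eventually_exists_window (hK : IsCompact K) (hne : K.Nonempty)
    (hf : ∀ j, Continuous (f j)) {C : ℝ} (hC0 : 0 ≤ C)
    (hC : ∀ j, ∀ z ∈ seqIn K, ∀ w ∈ seqIn K, |f j (z, w)| ≤ C)
    {l : ℕ} (hloc : ∀ j, DependsOnFirst l (f j))
    {ξ : Measure ((ℕ → ℂ) × (ℕ → ℂ))} [IsProbabilityMeasure ξ] (hinv : MeasurePreserving shift2 ξ ξ)
    (hsupp : ∀ᵐ p ∂ξ, p ∈ seqIn K ×ˢ seqIn K) (h0 : ∀ j, ∫ p, f j p ∂ξ = 0)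
    {x : ℕ → ℂ} (hx : x ∈ seqIn K)
    (hgen : ∀ g : (ℕ → ℂ) → ℝ, Continuous g →
      Tendsto (fun n : ℕ => (n : ℝ)⁻¹ * ∑ i ∈ Finset.range n, g (shift^[i] x)) atTop
        (𝓝 (∫ z, g z ∂(ξ.map Prod.fst))))
    {c : ℕ} (hc : 0 < c) {ε : ℝ} (hε : 0 < ε) :
    ∀ᶠ a : ℕ in atTop, ∃ y ∈ seqIn K, ∀ j,
      |∑ t ∈ Finset.Ico a (a + (a / c + 1)), f j (shift^[t] x, shift^[t] y)|
        ≤ ε * ((a / c + 1 : ℕ) : ℝ) := by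
  set D : ℝ := Fintype.card ι * (1 * C) with hD
  have hD0 : 0 ≤ D := by positivity
  obtain ⟨N, hN⟩ : ∃ N : ℕ, (2 + 4 * D * l) / ε ≤ N := exists_nat_ge _
  rw [div_le_iff₀ hε] at hN
  set G : ℝ := Fintype.card ι * ((l + N) * (2 * C)) ^ 2 with hG
  have hG0 : 0 ≤ G := by positivity
  have hlen : Tendsto (fun a : ℕ => ((a / c + 1 : ℕ) : ℝ)) atTop atTop :=
    tendsto_natCast_atTop_atTop.comp
      ((tendsto_add_atTop_nat 1).comp (Nat.tendsto_div_const_atTop hc.ne'))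
  filter_upwards [eventually_window_maxSum_ge hK hne hf hC hinv hsupp h0 hx hgen hc N,
    hlen.eventually_gt_atTop (2 * D * N ^ 2 + G / (2 * ε)), hlen.eventually_ge_atTop (N : ℝ)]
    with a hM hL hNL
  have hNL : N ≤ a / c + 1 := by exact_mod_cast hNL
  set m := a / c + 1 with hm
  set L : ℝ := (m : ℝ) with hLdef
  have hLpos : 0 < L := by
    have : 0 ≤ 2 * D * N ^ 2 + G / (2 * ε) := by positivity
    linarith
  let S : ι → (ℕ → ℂ) → ℝ := fun j y =>
    ∑ t ∈ Finset.Ico a (a + m), f j (shift^[t] x, shift^[t] y)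
  have hScont : Continuous fun y => ∑ j, S j y ^ 2 := by
    refine continuous_finsetSum _ fun j _ => Continuous.pow ?_ 2
    refine continuous_finsetSum _ fun t _ => (hf j).comp ?_
    exact continuous_const.prodMk (continuous_shift_iterate t)
  obtain ⟨k, hk⟩ := id hne
  obtain ⟨y, hy, hmin⟩ := (isCompact_seqIn hK).exists_isMinOn
    (⟨fun _ => k, fun _ => hk⟩ : (seqIn K).Nonempty) hScont.continuousOn
  refine ⟨y, hy, ?_⟩
  set R : ℝ := √(∑ j, S j y ^ 2) with hR
  have hSR : ∀ j, |S j y| ≤ R := fun j => Real.abs_le_sqrt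
    (Finset.single_le_sum (f := fun j => S j y ^ 2) (fun _ _ => sq_nonneg _) (Finset.mem_univ j))
  suffices R ≤ ε * L from fun j => (hSR j).trans this
  by_contra! hlt
  have hRpos : 0 < R := lt_of_le_of_lt (by positivity) hlt
  have hRsq : ∑ j, S j y ^ 2 = R ^ 2 := (Real.sq_sqrt (Finset.sum_nonneg fun _ _ => sq_nonneg _)).symm
  let θ : ι → ℝ := fun j => -S j y / R
  have hθ : ∀ j, |θ j| ≤ 1 := fun j => by
    simp only [θ, abs_div, abs_neg, abs_of_pos hRpos]
    exact (div_le_one hRpos).2 (hSR j)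
  have hθmem : θ ∈ Set.Icc (-1 : ι → ℝ) 1 :=
    ⟨fun j => (abs_le.1 (hθ j)).1, fun j => (abs_le.1 (hθ j)).2⟩
  let h : (ℕ → ℂ) × (ℕ → ℂ) → ℝ := fun p => ∑ j, θ j * f j p
  have hhC : ∀ z ∈ seqIn K, ∀ w ∈ seqIn K, |h (z, w)| ≤ D := fun z hz w hw =>
    abs_combination_le (p := (z, w)) ⟨hz, hw⟩ hC hθ
  have hhloc : DependsOnFirst l h := fun z w w' hw =>
    Finset.sum_congr rfl fun j _ => by rw [hloc j z w w' hw]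
  have hsumh : ∀ w, ∑ t ∈ Finset.Ico a (a + m), h (shift^[t] x, shift^[t] w)
      = ∑ j, θ j * S j w := fun w => by
    simp only [h, S, Finset.mul_sum]
    exact Finset.sum_comm
  have hsumR : ∑ t ∈ Finset.Ico a (a + m), h (shift^[t] x, shift^[t] y) = -R := by
    rw [hsumh]
    have : ∑ j, θ j * S j y = -(∑ j, S j y ^ 2) / R := by
      rw [← Finset.sum_neg_distrib, Finset.sum_div]
      exact Finset.sum_congr rfl fun j _ => by simp only [θ]; ring
    rw [this, hRsq]; field_simp
  have hstep : ∀ i ∈ Finset.Ico a (a + m - N), maxSum K f N θ (shift^[i] x)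
      - ∑ t ∈ Finset.range N, h (shift^[i + t] x, shift^[i + t] y)
      ≤ 4 * D * l + G / (2 * R) := by
    intro i hi
    rw [Finset.mem_Ico] at hi
    obtain ⟨v, hv, hvM⟩ := exists_eq_maxSum hK hne hf N θ (shift^[i] x)
    have h1 := hhloc.abs_sum_splice_sub_le hD0 hhC hx hy hv (b := a + m) hi.1 (N := N) (by omega)
    have h2 : ∑ j, θ j * (S j (splice y v i N) - S j y) ≤ G / (2 * R) :=
      sum_neg_div_mul_le hRpos
        (fun j => (hloc j).abs_sum_splice_sub_le_add hC0 (hC j) hx hy hv a (a + m) i N)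
        (by simpa using hmin (splice_mem hy hv i N))
    simp only [mul_sub, Finset.sum_sub_distrib, ← hsumh] at h2
    have h3 : ∑ t ∈ Finset.range N, h (shift^[t] (shift^[i] x), shift^[t] v)
      = maxSum K f N θ (shift^[i] x) := hvM
    rw [h3] at h1
    have := (abs_le.1 h1).1
    linarith
  have hsum := Finset.sum_le_card_nsmul _ _ _ hstep
  rw [Finset.sum_sub_distrib, nsmul_eq_mul, Nat.card_Ico] at hsum
  have hblock := sum_block_sum_le (u := fun t => h (shift^[t] x, shift^[t] y)) hD0
    (fun t => hhC _ (shift_iterate_mem hx t) _ (shift_iterate_mem hy t)) (a := a) (b := a + m)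
    (N := N) (by omega)
  rw [hsumR] at hblock
  have hsplit := Finset.sum_Ico_consecutive (fun i => maxSum K f N θ (shift^[i] x))
    (show a ≤ a + m - N by omega) (Nat.sub_le (a + m) N)
  have htail : ∑ i ∈ Finset.Ico (a + m - N) (a + m), maxSum K f N θ (shift^[i] x) ≤ N * (N * D) := by
    refine (Finset.sum_le_card_nsmul _ _ (N * D) fun i _ =>
      maxSum_le hK hne hf hC N hθ (shift_iterate_mem hx i)).trans ?_
    rw [nsmul_eq_mul, Nat.card_Ico]
    refine mul_le_mul_of_nonneg_right ?_ (by positivity)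
    exact_mod_cast (by omega)
  have hMθ := hM θ hθmem
  have hcard : ((a + m - N - a : ℕ) : ℝ) ≤ L := by
    rw [hLdef]; exact_mod_cast (by omega)
  have hrhs : ((a + m - N - a : ℕ) : ℝ) * (4 * D * l + G / (2 * R))
      ≤ L * (4 * D * l) + G / (2 * ε) := by
    refine (mul_le_mul_of_nonneg_right hcard (by positivity)).trans ?_
    rw [mul_add]
    have : L * (G / (2 * R)) ≤ G / (2 * ε) := by
      rw [mul_div_assoc', div_le_div_iff₀ (by positivity) (by positivity)]
      nlinarith
    linarith
  have hNR : N * (ε * L) ≤ N * R := mul_le_mul_of_nonneg_left hlt.le (Nat.cast_nonneg _)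
  have hNε : (2 + 4 * D * l) * L ≤ N * ε * L := mul_le_mul_of_nonneg_right hN hLpos.le
  nlinarith

end Window

lemma exists_tendsto_atTop_eventually_diagonal {P : ℕ → ℕ → Prop}
    (h : ∀ s, ∀ᶠ a in atTop, P s a) :
    ∃ s : ℕ → ℕ, Tendsto s atTop atTop ∧ ∀ᶠ a in atTop, P (s a) a := by
  classical
  simp only [eventually_atTop] at h
  choose A hA using h
  refine ⟨fun a => Nat.findGreatest (fun s => A s ≤ a) a, ?_, ?_⟩
  · refine tendsto_atTop.2 fun s => ?_
    filter_upwards [eventually_ge_atTop (max s (A s))] with a ha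
    exact Nat.le_findGreatest (le_of_max_le_left ha) (le_of_max_le_right ha)
  · filter_upwards [eventually_ge_atTop (A 0)] with a ha
    exact hA _ _ (Nat.findGreatest_spec (P := fun s => A s ≤ a) (Nat.zero_le a) ha)

lemma exists_concat {K : Set ℂ} {T : ℕ → ℕ} (hT : StrictMono T) {Y : ℕ → ℕ → ℂ}
    (hY : ∀ k, Y k ∈ seqIn K) :
    ∃ y ∈ seqIn K, ∀ k n, T k ≤ n → n < T (k + 1) → y n = Y k n := by
  classical
  refine ⟨fun n => Y (Nat.findGreatest (fun k => T k ≤ n) n) n, fun n => hY _ n, fun k n h1 h2 => ?_⟩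
  have : Nat.findGreatest (fun k => T k ≤ n) n = k := by
    rw [Nat.findGreatest_eq_iff]
    refine ⟨(hT.id_le k).trans h1, fun _ => h1, fun j hj _ hjn => ?_⟩
    have := hT.monotone (Nat.succ_le_of_lt hj)
    simp only [Nat.succ_eq_add_one] at this
    omega
  simp only [this]

/-- Averages tend to zero if they do so along consecutive intervals of relatively small length. -/
lemma tendsto_average_zero_of_intervals {u : ℕ → ℝ} {C : ℝ} (hu : ∀ t, |u t| ≤ C) {T : ℕ → ℕ}
    (hT : StrictMono T)
    (hsum : ∀ ε > 0, ∀ᶠ k in atTop,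
      |∑ t ∈ Finset.Ico (T k) (T (k + 1)), u t| ≤ ε * ((T (k + 1) : ℝ) - T k))
    (hlen : ∀ ε > 0, ∀ᶠ k in atTop, (T (k + 1) : ℝ) - T k ≤ ε * T k) :
    Tendsto (fun n : ℕ => (n : ℝ)⁻¹ * ∑ t ∈ Finset.range n, u t) atTop (𝓝 0) := by
  have hC0 : 0 ≤ C := (abs_nonneg _).trans (hu 0)
  have hbd : ∀ p q : ℕ, p ≤ q → |∑ t ∈ Finset.Ico p q, u t| ≤ ((q : ℝ) - p) * C := by
    intro p q hpq
    have := abs_sum_le_card_mul (T := Finset.Ico p q) hC0 (fun t _ => hu t)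
      (fun t ht hT => absurd ht hT)
    rwa [Nat.card_Ico, Nat.cast_sub hpq] at this
  rw [Metric.tendsto_atTop]
  intro ε' hε'
  set ε : ℝ := ε' / (C + 3) with hεdef
  have hε : 0 < ε := by positivity
  have hεC : ε * (C + 3) = ε' := by rw [hεdef]; field_simp
  obtain ⟨k0, hk0⟩ := eventually_atTop.1 ((hsum ε hε).and (hlen ε hε))
  have hind : ∀ k ≥ k0, |∑ t ∈ Finset.range (T k), u t|
      ≤ T k0 * C + ε * ((T k : ℝ) - T k0) := by
    intro k hk
    induction k, hk using Nat.le_induction with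
    | base =>
      have := hbd 0 (T k0) (Nat.zero_le _)
      rw [← Finset.range_eq_Ico] at this
      simpa using this
    | succ k hk ih =>
      rw [← Finset.sum_range_add_sum_Ico _ (hT (Nat.lt_succ_self k)).le]
      refine (abs_add_le _ _).trans ((add_le_add ih (hk0 k hk).1).trans (le_of_eq (by ring)))
  obtain ⟨n0, hn0⟩ := exists_nat_ge (T k0 * C / ε)
  rw [div_le_iff₀ hε] at hn0
  refine ⟨max (max n0 (T k0)) 1, fun n hn => ?_⟩
  have hn1 : n0 ≤ n := by omega
  have hn2 : T k0 ≤ n := by omega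
  have hnpos : (0 : ℝ) < n := by exact_mod_cast (by omega)
  obtain ⟨k, hk, h1, h2⟩ : ∃ k ≥ k0, T k ≤ n ∧ n < T (k + 1) := by
    classical
    have hex : ∃ k, n < T (k + 1) := ⟨n, (Nat.lt_succ_self n).trans_le (hT.id_le (n + 1))⟩
    have hmin : T (Nat.find hex) ≤ n := by
      rcases Nat.eq_zero_or_pos (Nat.find hex) with h | h
      · rw [h]; exact (hT.monotone (Nat.zero_le k0)).trans hn2
      · have := Nat.find_min hex (Nat.sub_lt h one_pos)
        rw [show Nat.find hex - 1 + 1 = Nat.find hex by omega] at this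
        omega
    refine ⟨Nat.find hex, ?_, hmin, Nat.find_spec hex⟩
    by_contra hlt
    have := hT.monotone (show Nat.find hex + 1 ≤ k0 by omega)
    have := Nat.find_spec hex
    omega
  have hlast := hbd (T k) n h1
  have hk1 := hind k hk
  have hk2 := (hk0 k hk).2
  have h1' : (T k : ℝ) ≤ n := by exact_mod_cast h1
  have h2' : (n : ℝ) ≤ T (k + 1) := by exact_mod_cast h2.le
  have hT0 : (0 : ℝ) ≤ T k0 := Nat.cast_nonneg _
  have hlast' : |∑ t ∈ Finset.Ico (T k) n, u t| ≤ (ε * n) * C := by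
    refine hlast.trans (mul_le_mul_of_nonneg_right ?_ hC0)
    have : ε * T k ≤ ε * n := by gcongr
    linarith
  have htot : |∑ t ∈ Finset.range n, u t| ≤ ε * (C + 2) * n := by
    rw [← Finset.sum_range_add_sum_Ico _ h1]
    refine (abs_add_le _ _).trans ?_
    have e1 : ε * ((T k : ℝ) - T k0) ≤ ε * n := mul_le_mul_of_nonneg_left (by linarith) hε.le
    have e2 : (n0 : ℝ) * ε ≤ n * ε := by gcongr
    linarith
  rw [Real.dist_eq, sub_zero, abs_mul, abs_of_pos (inv_pos.2 hnpos), inv_mul_lt_iff₀ hnpos, ← hεC]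
  refine htot.trans_lt ?_
  nlinarith

lemma DependsOnFirst.mono {f : (ℕ → ℂ) × (ℕ → ℂ) → ℝ} {l l' : ℕ} (hf : DependsOnFirst l f)
    (h : l ≤ l') : DependsOnFirst l' f :=
  fun z w w' hw => hf z w w' fun i hi => hw i (hi.trans_le h)

/-- A sequence of mean-zero functions depending on finitely many coordinates of the second
component can be averaged to zero simultaneously along some `(x, y)`. -/
lemma exists_forall_tendsto_average_zero {K : Set ℂ} (hK : IsCompact K)
    {g : ℕ → (ℕ → ℂ) × (ℕ → ℂ) → ℝ} (hg : ∀ m, Continuous (g m))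
    (hloc : ∀ m, ∃ l, DependsOnFirst l (g m))
    {ξ : Measure ((ℕ → ℂ) × (ℕ → ℂ))} [IsProbabilityMeasure ξ] (hinv : MeasurePreserving shift2 ξ ξ)
    (hsupp : ∀ᵐ p ∂ξ, p ∈ seqIn K ×ˢ seqIn K) (h0 : ∀ m, ∫ p, g m p ∂ξ = 0)
    {x : ℕ → ℂ} (hx : x ∈ seqIn K)
    (hgen : ∀ g : (ℕ → ℂ) → ℝ, Continuous g →
      Tendsto (fun n : ℕ => (n : ℝ)⁻¹ * ∑ i ∈ Finset.range n, g (shift^[i] x)) atTop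
        (𝓝 (∫ z, g z ∂(ξ.map Prod.fst)))) :
    ∃ y ∈ seqIn K, ∀ m, Tendsto
      (fun n : ℕ => (n : ℝ)⁻¹ * ∑ t ∈ Finset.range n, g m (shift^[t] x, shift^[t] y)) atTop
      (𝓝 0) := by
  have hne : K.Nonempty := ⟨x 0, hx 0⟩
  have hbound : ∀ m, ∃ C, 0 ≤ C ∧ ∀ z ∈ seqIn K, ∀ w ∈ seqIn K, |g m (z, w)| ≤ C := by
    intro m
    obtain ⟨C, hC⟩ := ((isCompact_seqIn hK).prod (isCompact_seqIn hK)).exists_bound_of_continuousOn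
      (hg m).continuousOn
    exact ⟨C, (norm_nonneg _).trans (hC (x, x) ⟨hx, hx⟩), fun z hz w hw => hC (z, w) ⟨hz, hw⟩⟩
  choose C hC0 hC using hbound
  choose l hl using hloc
  have hscale : ∀ s : ℕ, ∀ᶠ a : ℕ in atTop, (∃ y ∈ seqIn K, ∀ m ≤ s,
      |∑ t ∈ Finset.Ico a (a + (a / (s + 1) + 1)), g m (shift^[t] x, shift^[t] y)|
        ≤ 1 / (s + 1) * ((a / (s + 1) + 1 : ℕ) : ℝ)) ∧ s + 1 ≤ a / (s + 1) := by
    intro s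
    have hw := eventually_exists_window (f := fun j : Fin (s + 1) => g j) hK hne (fun j => hg j)
      (C := ∑ m ∈ Finset.range (s + 1), C m) (Finset.sum_nonneg fun m _ => hC0 m)
      (fun j z hz w hw => (hC j z hz w hw).trans
        (Finset.single_le_sum (f := C) (fun m _ => hC0 m) (Finset.mem_range.2 j.2)))
      (l := ∑ m ∈ Finset.range (s + 1), l m)
      (fun j => (hl j).mono
        (Finset.single_le_sum (f := l) (fun m _ => Nat.zero_le _) (Finset.mem_range.2 j.2)))
      hinv hsupp (fun j => h0 j) hx hgen (Nat.succ_pos s) (ε := 1 / (s + 1)) (by positivity)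
    filter_upwards [hw, (Nat.tendsto_div_const_atTop (Nat.succ_ne_zero s)).eventually_ge_atTop
      (s + 1)] with a ⟨y, hy, hya⟩ ha
    exact ⟨⟨y, hy, fun m hm => hya ⟨m, Nat.lt_succ_of_le hm⟩⟩, ha⟩
  obtain ⟨s, hs, hsP⟩ := exists_tendsto_atTop_eventually_diagonal hscale
  have hY : ∀ a, ∃ y ∈ seqIn K, (∃ y ∈ seqIn K, ∀ m ≤ s a,
      |∑ t ∈ Finset.Ico a (a + (a / (s a + 1) + 1)), g m (shift^[t] x, shift^[t] y)|
        ≤ 1 / (s a + 1) * ((a / (s a + 1) + 1 : ℕ) : ℝ)) → ∀ m ≤ s a,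
      |∑ t ∈ Finset.Ico a (a + (a / (s a + 1) + 1)), g m (shift^[t] x, shift^[t] y)|
        ≤ 1 / (s a + 1) * ((a / (s a + 1) + 1 : ℕ) : ℝ) := by
    intro a
    by_cases h : ∃ y ∈ seqIn K, ∀ m ≤ s a,
      |∑ t ∈ Finset.Ico a (a + (a / (s a + 1) + 1)), g m (shift^[t] x, shift^[t] y)|
        ≤ 1 / (s a + 1) * ((a / (s a + 1) + 1 : ℕ) : ℝ)
    · obtain ⟨y, hy, h'⟩ := h
      exact ⟨y, hy, fun _ => h'⟩
    · exact ⟨x, hx, fun h' => absurd h' h⟩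
  choose Y hYmem hY using hY
  obtain ⟨T, hTs⟩ : ∃ T : ℕ → ℕ, ∀ k, T (k + 1) = T k + (T k / (s (T k) + 1) + 1) :=
    ⟨fun k => Nat.rec 0 (fun _ a => a + (a / (s a + 1) + 1)) k, fun _ => rfl⟩
  have hT : StrictMono T := strictMono_nat_of_lt_succ fun k => by
    rw [hTs]; exact Nat.lt_add_of_pos_right (Nat.succ_pos _)
  obtain ⟨y, hy, hyY⟩ := exists_concat hT (fun k => hYmem (T k))
  have hgood := hT.tendsto_atTop.eventually hsP
  have hsT : Tendsto (fun k => s (T k)) atTop atTop := hs.comp hT.tendsto_atTop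
  have hsmall : ∀ B : ℝ, ∀ ε > 0, ∀ᶠ k in atTop, B / ((s (T k) : ℝ) + 1) ≤ ε := by
    intro B ε hε
    have h1 := (tendsto_natCast_atTop_atTop (R := ℝ)).comp hsT
    filter_upwards [h1.eventually_ge_atTop (B / ε)] with k hk
    rw [div_le_iff₀ (by positivity)]
    rw [Function.comp_apply, div_le_iff₀ hε] at hk
    nlinarith
  refine ⟨y, hy, fun m => tendsto_average_zero_of_intervals (C := C m)
    (fun t => hC m _ (shift_iterate_mem hx t) _ (shift_iterate_mem hy t)) hT ?_ ?_⟩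
  · intro ε hε
    filter_upwards [hgood, hsT.eventually_ge_atTop m, hsmall (1 + l m * (2 * C m)) ε hε]
      with k ⟨hk1, hk2⟩ hmk hk3
    have hYk := hY (T k) hk1 m hmk
    rw [← hTs] at hYk
    have hdiff : |∑ t ∈ Finset.Ico (T k) (T (k + 1)), (g m (shift^[t] x, shift^[t] y)
        - g m (shift^[t] x, shift^[t] (Y (T k))))|
        ≤ (Finset.Ico (T (k + 1) - l m) (T (k + 1))).card * (2 * C m) := by
      refine abs_sum_le_card_mul (by linarith [hC0 m]) (fun t _ => ?_) fun t ht htT => ?_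
      · have h1 := hC m _ (shift_iterate_mem hx t) _ (shift_iterate_mem hy t)
        have h2 := hC m _ (shift_iterate_mem hx t) _ (shift_iterate_mem (hYmem (T k)) t)
        exact (abs_sub _ _).trans (by linarith)
      · rw [Finset.mem_Ico] at ht htT
        rw [hl m _ (shift^[t] y) (shift^[t] (Y (T k))) fun i hi => ?_, sub_self]
        rw [shift_iterate_apply, shift_iterate_apply]
        exact hyY k _ (by omega) (by omega)
    rw [Finset.sum_sub_distrib] at hdiff
    have hcard : ((Finset.Ico (T (k + 1) - l m) (T (k + 1))).card : ℝ) ≤ l m := by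
      rw [Nat.card_Ico]; exact_mod_cast (by omega)
    have hdiff' := hdiff.trans (mul_le_mul_of_nonneg_right hcard (by linarith [hC0 m]))
    have hL : (T (k + 1) : ℝ) - T k = ((T k / (s (T k) + 1) + 1 : ℕ) : ℝ) := by
      rw [hTs, Nat.cast_add (T k)]; ring
    rw [hL]
    set L : ℝ := ((T k / (s (T k) + 1) + 1 : ℕ) : ℝ) with hLdef
    have hLs : (s (T k) : ℝ) + 1 ≤ L := by
      rw [hLdef]; exact_mod_cast (by omega)
    have hspos : (0 : ℝ) < (s (T k) : ℝ) + 1 := by positivity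
    have hLB : l m * (2 * C m) ≤ l m * (2 * C m) / ((s (T k) : ℝ) + 1) * L := by
      rw [div_mul_eq_mul_div, le_div_iff₀ hspos]
      exact mul_le_mul_of_nonneg_left hLs
        (mul_nonneg (Nat.cast_nonneg _) (by linarith [hC0 m]))
    have hfin : (1 + l m * (2 * C m)) / ((s (T k) : ℝ) + 1) * L ≤ ε * L :=
      mul_le_mul_of_nonneg_right hk3 (by linarith)
    rw [add_div, add_mul] at hfin
    rw [abs_le] at *
    constructor <;> linarith
  · intro ε hε
    filter_upwards [hgood, hsmall 2 ε hε] with k ⟨_, hk2⟩ hk3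
    rw [hTs, Nat.cast_add (T k), add_sub_cancel_left]
    have hspos : (0 : ℝ) < (s (T k) : ℝ) + 1 := by positivity
    have h1 : ((T k / (s (T k) + 1) : ℕ) : ℝ) ≤ T k / ((s (T k) : ℝ) + 1) := by
      have := @Nat.cast_div_le ℝ _ _ _ (T k) (s (T k) + 1)
      exact_mod_cast this
    have h2 : (1 : ℝ) ≤ ((T k / (s (T k) + 1) : ℕ) : ℝ) := by exact_mod_cast (by omega)
    have h3 : 2 / ((s (T k) : ℝ) + 1) * T k ≤ ε * T k :=
      mul_le_mul_of_nonneg_right hk3 (Nat.cast_nonneg _)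
    have h4 : 2 / ((s (T k) : ℝ) + 1) * T k = 2 * (T k / ((s (T k) : ℝ) + 1)) := by ring
    push_cast at *
    linarith

section Words

variable {K : Set ℂ}

/-- A continuous function that is `1` at `a` and `0` at the other points of `s`. -/
def bump (s : Finset ℂ) (a z : ℂ) : ℝ := ∏ c ∈ s.erase a, ‖z - c‖ / ‖a - c‖

lemma continuous_bump (s : Finset ℂ) (a : ℂ) : Continuous (bump s a) := by
  unfold bump; fun_prop

lemma bump_eq_ite {s : Finset ℂ} (a : ℂ) {z : ℂ} (hz : z ∈ s) :
    bump s a z = if z = a then 1 else 0 := by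
  split_ifs with h
  · subst h
    refine Finset.prod_eq_one fun c hc => div_self ?_
    exact norm_ne_zero_iff.2 (sub_ne_zero.2 (Finset.ne_of_mem_erase hc).symm)
  · exact Finset.prod_eq_zero (Finset.mem_erase.2 ⟨h, hz⟩) (by simp)

/-- A continuous function which on pairs of `s`-valued sequences is the indicator of the cylinder
given by the word `w`. -/
def cylinderFun (s : Finset ℂ) {l : ℕ} (w : Fin l → K × K) (p : (ℕ → ℂ) × (ℕ → ℂ)) : ℝ :=
  ∏ i, bump s (w i).1 (p.1 i) * bump s (w i).2 (p.2 i)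

lemma continuous_cylinderFun (s : Finset ℂ) {l : ℕ} (w : Fin l → K × K) :
    Continuous (cylinderFun s w) := by
  refine continuous_finsetProd _ fun i _ => ?_
  exact ((continuous_bump s _).comp ((continuous_apply _).comp continuous_fst)).mul
    ((continuous_bump s _).comp ((continuous_apply _).comp continuous_snd))

lemma dependsOnFirst_cylinderFun (s : Finset ℂ) {l : ℕ} (w : Fin l → K × K) :
    DependsOnFirst l (cylinderFun s w) := fun z v v' h =>
  Finset.prod_congr rfl fun i _ => by simp only [h i i.2]

/-- The first `l` terms of a pair of `K`-valued sequences. -/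
def prefixWord (l : ℕ) {p : (ℕ → ℂ) × (ℕ → ℂ)} (hp : p ∈ seqIn K ×ˢ seqIn K) : Fin l → K × K :=
  fun i => (⟨p.1 i, hp.1 i⟩, ⟨p.2 i, hp.2 i⟩)

lemma cylinderFun_eq_ite (hK : K.Finite) {l : ℕ} (w : Fin l → K × K) {p : (ℕ → ℂ) × (ℕ → ℂ)}
    (hp : p ∈ seqIn K ×ˢ seqIn K) :
    cylinderFun hK.toFinset w p = if w = prefixWord l hp then 1 else 0 := by
  have h1 : ∀ i, bump hK.toFinset (w i).1 (p.1 i) = if p.1 i = (w i).1 then 1 else 0 :=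
    fun i => bump_eq_ite _ (hK.mem_toFinset.2 (hp.1 i))
  have h2 : ∀ i, bump hK.toFinset (w i).2 (p.2 i) = if p.2 i = (w i).2 then 1 else 0 :=
    fun i => bump_eq_ite _ (hK.mem_toFinset.2 (hp.2 i))
  simp only [cylinderFun, h1, h2]
  split_ifs with h
  · subst h
    simp [prefixWord]
  · obtain ⟨i, hi⟩ := Function.ne_iff.1 h
    refine Finset.prod_eq_zero (Finset.mem_univ i) ?_
    by_contra hne
    refine hi (Prod.ext (Subtype.ext ?_) (Subtype.ext ?_))
    · by_contra hc
      have hc' : p.1 i ≠ (w i).1 := Ne.symm hc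
      exact hne (by rw [if_neg hc', zero_mul])
    · by_contra hc
      have hc' : p.2 i ≠ (w i).2 := Ne.symm hc
      exact hne (by rw [if_neg hc', mul_zero])

/-- Extend a word to a pair of sequences by the constant value `k`. -/
def extendWord (k : ℂ) {l : ℕ} (w : Fin l → K × K) : (ℕ → ℂ) × (ℕ → ℂ) :=
  (fun n => if h : n < l then (w ⟨n, h⟩).1 else k, fun n => if h : n < l then (w ⟨n, h⟩).2 else k)

lemma extendWord_mem {k : ℂ} (hk : k ∈ K) {l : ℕ} (w : Fin l → K × K) :
    extendWord k w ∈ seqIn K ×ˢ seqIn K := by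
  constructor <;> intro n <;> simp only [extendWord] <;> split_ifs <;> simp [hk]

/-- A continuous function on a compact product of symbolic spaces is determined by finitely many
coordinates up to a small error. -/
lemma exists_forall_prefix_dist_le (hK : IsCompact K) {f : (ℕ → ℂ) × (ℕ → ℂ) → ℂ}
    (hf : Continuous f) {ε : ℝ} (hε : 0 < ε) :
    ∃ l : ℕ, ∀ p ∈ seqIn K ×ˢ seqIn K, ∀ q ∈ seqIn K ×ˢ seqIn K,
      (∀ i < l, p.1 i = q.1 i ∧ p.2 i = q.2 i) → dist (f p) (f q) ≤ ε := by
  by_contra! hcon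
  choose p hp q hq hpq hdist using hcon
  obtain ⟨a, -, φ, hφ, hlim⟩ :=
    ((isCompact_seqIn hK).prod (isCompact_seqIn hK)).tendsto_subseq hp
  have hlim' : Tendsto (q ∘ φ) atTop (𝓝 a) := by
    have h1 := (continuous_fst.tendsto a).comp hlim
    have h2 := (continuous_snd.tendsto a).comp hlim
    rw [tendsto_pi_nhds] at h1 h2
    rw [Prod.tendsto_iff, tendsto_pi_nhds, tendsto_pi_nhds]
    refine ⟨fun i => (h1 i).congr' ?_, fun i => (h2 i).congr' ?_⟩ <;>
      filter_upwards [eventually_gt_atTop i] with n hn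
    · exact (hpq (φ n) i (hn.trans_le (hφ.id_le n))).1
    · exact (hpq (φ n) i (hn.trans_le (hφ.id_le n))).2
  have h := ((hf.tendsto a).comp hlim).dist ((hf.tendsto a).comp hlim')
  rw [dist_self] at h
  obtain ⟨n, hn⟩ := (h.eventually_lt_const hε).exists
  exact absurd hn (not_lt.2 (hdist (φ n)).le)

/-- Uniform approximation of continuous functions by combinations of cylinder functions. -/
lemma exists_cylinderFun_approx (hK : K.Finite) (hne : K.Nonempty) {f : (ℕ → ℂ) × (ℕ → ℂ) → ℂ}
    (hf : Continuous f) {ε : ℝ} (hε : 0 < ε) :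
    ∃ (l : ℕ) (c : (Fin l → K × K) → ℂ), ∀ p ∈ seqIn K ×ˢ seqIn K,
      ‖f p - ∑ᶠ w : Fin l → K × K, c w * (cylinderFun hK.toFinset w p : ℂ)‖ ≤ ε := by
  have : Finite K := hK
  obtain ⟨k, hk⟩ := hne
  obtain ⟨l, hl⟩ := exists_forall_prefix_dist_le hK.isCompact hf hε
  refine ⟨l, fun w => f (extendWord k w), fun p hp => ?_⟩
  rw [finsum_eq_single _ (prefixWord l hp) fun w hw => by
    rw [cylinderFun_eq_ite hK w hp, if_neg hw]; simp]
  rw [cylinderFun_eq_ite hK _ hp, if_pos rfl, Complex.ofReal_one, mul_one, ← dist_eq_norm]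
  refine hl p hp _ (extendWord_mem hk _) fun i hi => ?_
  simp [extendWord, prefixWord, hi]

/-- Convergence of averages of cylinder functions implies convergence of averages of all
continuous functions. -/
lemma tendsto_average_of_cylinderFun (hK : K.Finite) {ξ : Measure ((ℕ → ℂ) × (ℕ → ℂ))}
    [IsProbabilityMeasure ξ] (hsupp : ∀ᵐ p ∂ξ, p ∈ seqIn K ×ˢ seqIn K)
    {q : ℕ → (ℕ → ℂ) × (ℕ → ℂ)} (hq : ∀ t, q t ∈ seqIn K ×ˢ seqIn K)
    (hcyl : ∀ (l : ℕ) (w : Fin l → K × K), Tendsto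
      (fun n : ℕ => (n : ℝ)⁻¹ * ∑ t ∈ Finset.range n, cylinderFun hK.toFinset w (q t)) atTop
      (𝓝 (∫ p, cylinderFun hK.toFinset w p ∂ξ)))
    {f : (ℕ → ℂ) × (ℕ → ℂ) → ℂ} (hf : Continuous f) :
    Tendsto (fun n : ℕ => (n : ℂ)⁻¹ * ∑ t ∈ Finset.range n, f (q t)) atTop
      (𝓝 (∫ p, f p ∂ξ)) := by
  have hfin : Finite K := hK
  have := Fintype.ofFinite K
  have hcomp := (isCompact_seqIn hK.isCompact).prod (isCompact_seqIn hK.isCompact)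
  rw [Metric.tendsto_atTop]
  intro ε hε
  obtain ⟨l, c, hc⟩ := exists_cylinderFun_approx hK ⟨_, (hq 0).1 0⟩ hf (ε := ε / 4) (by positivity)
  simp only [finsum_eq_sum_of_fintype] at hc
  set F : (ℕ → ℂ) × (ℕ → ℂ) → ℂ := fun p => ∑ w, c w * (cylinderFun hK.toFinset w p : ℂ) with hF
  have hterm : ∀ w : Fin l → K × K, Continuous fun p => c w * (cylinderFun hK.toFinset w p : ℂ) :=
    fun w => continuous_const.mul (Complex.continuous_ofReal.comp (continuous_cylinderFun _ w))
  have hFc : Continuous F := continuous_finsetSum _ fun w _ => hterm w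
  have hFlim : Tendsto (fun n : ℕ => (n : ℂ)⁻¹ * ∑ t ∈ Finset.range n, F (q t)) atTop
      (𝓝 (∫ p, F p ∂ξ)) := by
    have e1 : ∫ p, F p ∂ξ = ∑ w, c w * ((∫ p, cylinderFun hK.toFinset w p ∂ξ : ℝ) : ℂ) := by
      rw [hF, integral_finsetSum _ fun w _ =>
        integrable_of_continuous_of_ae_mem hcomp hsupp (hterm w)]
      refine Finset.sum_congr rfl fun w _ => ?_
      rw [integral_const_mul, integral_complex_ofReal]
    have e2 : ∀ n : ℕ, (n : ℂ)⁻¹ * ∑ t ∈ Finset.range n, F (q t) = ∑ w, c w *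
        (((n : ℝ)⁻¹ * ∑ t ∈ Finset.range n, cylinderFun hK.toFinset w (q t) : ℝ) : ℂ) := by
      intro n
      simp only [hF]
      rw [Finset.sum_comm, Finset.mul_sum]
      refine Finset.sum_congr rfl fun w _ => ?_
      rw [← Finset.mul_sum]
      push_cast
      ring
    simp only [e1, e2]
    exact tendsto_finsetSum _ fun w _ =>
      ((Complex.continuous_ofReal.tendsto _).comp (hcyl l w)).const_mul (c w)
  have hFf : ‖∫ p, F p ∂ξ - ∫ p, f p ∂ξ‖ ≤ ε / 4 := by
    rw [← integral_sub (integrable_of_continuous_of_ae_mem hcomp hsupp hFc)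
      (integrable_of_continuous_of_ae_mem hcomp hsupp hf)]
    refine (norm_integral_le_of_norm_le_const (C := ε / 4) ?_).trans (by simp)
    filter_upwards [hsupp] with p hp
    rw [norm_sub_rev]
    exact hc p hp
  obtain ⟨n0, hn0⟩ := Metric.tendsto_atTop.1 hFlim (ε / 4) (by positivity)
  refine ⟨n0, fun n hn => ?_⟩
  have h1 := hn0 n hn
  have h2 : ‖(n : ℂ)⁻¹ * ∑ t ∈ Finset.range n, f (q t)
      - (n : ℂ)⁻¹ * ∑ t ∈ Finset.range n, F (q t)‖ ≤ ε / 4 := by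
    rw [← mul_sub, ← Finset.sum_sub_distrib, norm_mul, norm_inv, Complex.norm_natCast]
    have h3 : ‖∑ t ∈ Finset.range n, (f (q t) - F (q t))‖ ≤ n * (ε / 4) := by
      refine (norm_sum_le _ _).trans ?_
      exact (Finset.sum_le_card_nsmul _ _ (ε / 4) fun t _ => hc _ (hq t)).trans (by simp)
    rcases Nat.eq_zero_or_pos n with rfl | hpos
    · simp; positivity
    · rwa [inv_mul_le_iff₀ (by exact_mod_cast hpos)]
  rw [dist_eq_norm] at h1 ⊢
  have e : (n : ℂ)⁻¹ * ∑ t ∈ Finset.range n, f (q t) - ∫ p, f p ∂ξ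
      = ((n : ℂ)⁻¹ * ∑ t ∈ Finset.range n, f (q t) - (n : ℂ)⁻¹ * ∑ t ∈ Finset.range n, F (q t))
      + ((n : ℂ)⁻¹ * ∑ t ∈ Finset.range n, F (q t) - ∫ p, F p ∂ξ)
      + (∫ p, F p ∂ξ - ∫ p, f p ∂ξ) := by ring
  rw [e]
  refine (norm_add₃_le).trans_lt ?_
  linarith

/-- Lifting of generic points, for averages starting at time zero. -/
lemma exists_generic_lift (hK : K.Finite)
    {ξ : Measure ((ℕ → ℂ) × (ℕ → ℂ))} [IsProbabilityMeasure ξ] (hinv : MeasurePreserving shift2 ξ ξ)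
    (hsupp : ∀ᵐ p ∂ξ, p ∈ seqIn K ×ˢ seqIn K) {x : ℕ → ℂ} (hx : x ∈ seqIn K)
    (hgen : ∀ g : (ℕ → ℂ) → ℝ, Continuous g →
      Tendsto (fun n : ℕ => (n : ℝ)⁻¹ * ∑ i ∈ Finset.range n, g (shift^[i] x)) atTop
        (𝓝 (∫ z, g z ∂(ξ.map Prod.fst)))) :
    ∃ y ∈ seqIn K, ∀ f : (ℕ → ℂ) × (ℕ → ℂ) → ℂ, Continuous f →
      Tendsto (fun n : ℕ => (n : ℂ)⁻¹ * ∑ t ∈ Finset.range n, f (shift^[t] x, shift^[t] y)) atTop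
        (𝓝 (∫ p, f p ∂ξ)) := by
  have hfin : Finite K := hK
  have hcomp := (isCompact_seqIn hK.isCompact).prod (isCompact_seqIn hK.isCompact)
  have : Nonempty (Σ l : ℕ, Fin l → K × K) := ⟨⟨0, Fin.elim0⟩⟩
  obtain ⟨e, he⟩ := exists_surjective_nat (Σ l : ℕ, Fin l → K × K)
  obtain ⟨y, hy, hlim⟩ := exists_forall_tendsto_average_zero hK.isCompact
    (g := fun m p => cylinderFun hK.toFinset (e m).2 p - ∫ p, cylinderFun hK.toFinset (e m).2 p ∂ξ)
    (fun m => (continuous_cylinderFun _ _).sub continuous_const)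
    (fun m => ⟨(e m).1, fun z w w' h =>
      congrArg (· - _) (dependsOnFirst_cylinderFun hK.toFinset (e m).2 z w w' h)⟩)
    hinv hsupp
    (fun m => by
      rw [integral_sub (integrable_of_continuous_of_ae_mem hcomp hsupp (continuous_cylinderFun _ _))
        (integrable_const _)]
      simp) hx hgen
  refine ⟨y, hy, fun f hf => tendsto_average_of_cylinderFun hK hsupp
    (fun t => ⟨shift_iterate_mem hx t, shift_iterate_mem hy t⟩) (fun l w => ?_) hf⟩
  obtain ⟨m, hm⟩ := he ⟨l, w⟩
  have h := (hlim m).add_const (∫ p, cylinderFun hK.toFinset (e m).2 p ∂ξ)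
  rw [hm, zero_add] at h
  refine h.congr' ?_
  filter_upwards [eventually_gt_atTop 0] with n hn
  have hn' : (n : ℝ) ≠ 0 := by exact_mod_cast hn.ne'
  rw [Finset.sum_sub_distrib]
  simp only [Finset.sum_const, Finset.card_range, nsmul_eq_mul]
  field_simp
  ring

end Words

/-- **lifting lemma for generic points.** Given a joining `ξ` of `μ` and `ν`
and a point `x` generic for `μ`, there exists `y` such that `(x,y)` is generic for `ξ`
(in particular `y` is generic for `ν`). -/
theorem stmt6 (K : Set ℂ) (hKfin : K.Finite) (hKball : K ⊆ Metric.closedBall 0 1)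
    (μ ν : Measure (ℕ → ℂ)) (hμ : InvariantProb μ) (hν : InvariantProb ν)
    (hμK : SupportedOn μ K) (hνK : SupportedOn ν K)
    (ξ : Measure ((ℕ → ℂ) × (ℕ → ℂ))) (hξ : IsJoining ξ μ ν)
    (x : ℕ → ℂ) (hx : ∀ n, x n ∈ K) (hgen : IsGeneric x μ) :
    ∃ y : ℕ → ℂ, (∀ n, y n ∈ K) ∧ IsGeneric2 (x, y) ξ ∧ IsGeneric y ν := by
  obtain ⟨hprob, hinv, hfst, hsnd⟩ := hξ
  have hmeas : MeasurableSet (seqIn K) := (isCompact_seqIn hKfin.isCompact).isClosed.measurableSet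
  have hμae : ∀ᵐ z ∂(ξ.map Prod.fst), z ∈ seqIn K := by
    rw [hfst]
    have := hμ.1
    exact (mem_ae_iff_prob_eq_one hmeas).2 hμK
  have hνae : ∀ᵐ z ∂(ξ.map Prod.snd), z ∈ seqIn K := by
    rw [hsnd]
    have := hν.1
    exact (mem_ae_iff_prob_eq_one hmeas).2 hνK
  have hsupp : ∀ᵐ p ∂ξ, p ∈ seqIn K ×ˢ seqIn K := by
    filter_upwards [ae_of_ae_map measurable_fst.aemeasurable hμae,
      ae_of_ae_map measurable_snd.aemeasurable hνae] with p h1 h2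
    exact ⟨h1, h2⟩
  have hgen' : ∀ g : (ℕ → ℂ) → ℝ, Continuous g →
      Tendsto (fun n : ℕ => (n : ℝ)⁻¹ * ∑ i ∈ Finset.range n, g (shift^[i] (shift x))) atTop
        (𝓝 (∫ z, g z ∂(ξ.map Prod.fst))) := by
    intro g hg
    have h := hgen ⟨fun z => (g z : ℂ), Complex.continuous_ofReal.comp hg⟩
    simp only [ContinuousMap.coe_mk, integral_complex_ofReal] at h
    have h' := (Complex.continuous_re.tendsto _).comp h
    rw [Complex.ofReal_re] at h'
    rw [hfst]
    refine (h'.congr fun n => ?_)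
    simp only [Function.comp_apply, Function.iterate_succ_apply]
    rw [← Complex.ofReal_sum, ← Complex.ofReal_natCast, ← Complex.ofReal_inv, ← Complex.ofReal_mul,
      Complex.ofReal_re]
  obtain ⟨v, hv, hlim⟩ := exists_generic_lift hKfin hinv hsupp
    (shift_iterate_mem (x := x) hx 1) hgen'
  let y : ℕ → ℂ := fun n => Nat.casesOn n (x 0) v
  have hyshift : shift y = v := rfl
  have hgen2 : IsGeneric2 (x, y) ξ := by
    intro f
    refine (hlim f f.continuous).congr fun n => ?_
    simp only [shift2_iterate]
    rfl
  refine ⟨y, fun n => ?_, hgen2, fun f => ?_⟩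
  · cases n with
    | zero => exact hx 0
    | succ n => exact hv n
  · have h := hgen2 (f.comp ⟨Prod.snd, continuous_snd⟩)
    simp only [ContinuousMap.comp_apply, ContinuousMap.coe_mk, shift2_iterate] at h
    rwa [← hsnd, integral_map measurable_snd.aemeasurable
      f.continuous.measurable.aestronglyMeasurable]
end
end

section
/- Let μ be a shift-invariant Borel probability measure on K^ℕ, let B ∈ K^n, let m ≤ n and ε > 0, and let l < n·(1−√ε). If both B and its prefix B_{[1,l]} are (m,ε)-generic for μ, then the suffix B_{[l+1,n]} is (m, 3√ε)-generic for μ. -/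
open MeasureTheory Filter Topology

noncomputable section

/-- The empirical (sub-probability) measure on blocks of length `m` determined by the block
`B` of length `n` (given by the first `n` values of `B : ℕ → K`): the count of occurrences
of `D` among positions `0,…,n−m`, normalized by `n`. -/
def empMeas {K : Type*} [DecidableEq K] (B : ℕ → K) (n m : ℕ) : (Fin m → K) → ℝ :=
  fun D => (n : ℝ)⁻¹ *
    ((Finset.range (n - m + 1)).filter fun i => ∀ j : Fin m, B (i + j.1) = D j).card

/-- The `ℓ¹` distance between two (sub-probability) vectors indexed by blocks of length `m`. -/
def dm {K : Type*} [Fintype K] (m : ℕ) (μ ν : (Fin m → K) → ℝ) : ℝ :=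
  ∑ D : Fin m → K, |μ D - ν D|

/-- The vector of cylinder measures of blocks of length `m` for a measure on `K^ℕ`. -/
def cylVec {K : Type*} [MeasurableSpace K] (μ : Measure (ℕ → K)) (m : ℕ) :
    (Fin m → K) → ℝ :=
  fun D => (μ {z : ℕ → K | ∀ j : Fin m, z j.1 = D j}).toReal

/-- The number of occurrences of `D` in `B` at positions below `N`. -/
def occCount {K : Type*} [DecidableEq K] (B : ℕ → K) (m N : ℕ) (D : Fin m → K) : ℕ :=
  ((Finset.range N).filter fun i => ∀ j : Fin m, B (i + j.1) = D j).card

lemma empMeas_eq_occCount {K : Type*} [DecidableEq K] (B : ℕ → K) (n m : ℕ) (D : Fin m → K) :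
    empMeas B n m D = (n : ℝ)⁻¹ * occCount B m (n - m + 1) D := rfl

lemma occCount_add {K : Type*} [DecidableEq K] (B : ℕ → K) (m a b : ℕ) (D : Fin m → K) :
    occCount B m (a + b) D = occCount B m a D + occCount (fun i => B (a + i)) m b D := by
  simp only [occCount, Finset.card_filter, Finset.sum_range_add, add_assoc]

lemma occCount_mono {K : Type*} [DecidableEq K] (B : ℕ → K) (m : ℕ) {a b : ℕ} (hab : a ≤ b)
    (D : Fin m → K) : occCount B m a D ≤ occCount B m b D :=
  Finset.card_le_card (Finset.filter_subset_filter _ (Finset.range_mono hab))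

lemma sum_occCount {K : Type*} [Fintype K] [DecidableEq K] (B : ℕ → K) (m N : ℕ) :
    ∑ D, occCount B m N D = N := by
  simp only [occCount, Finset.card_filter]
  rw [Finset.sum_comm]
  have h (i : ℕ) : ∑ D : Fin m → K, (if ∀ j : Fin m, B (i + j.1) = D j then 1 else 0) = 1 := by
    rw [Finset.sum_eq_single (fun j : Fin m => B (i + j.1))]
    · simp
    · intro D _ hD
      exact if_neg fun h => hD (funext fun j => (h j).symm)
    · simp
  simp [h]

lemma sum_abs_occCount_sub {K : Type*} [Fintype K] [DecidableEq K] (B : ℕ → K) (m a b : ℕ) :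
    ∑ D, |(occCount B m a D : ℝ) - occCount B m b D| = |(a : ℝ) - b| := by
  wlog hab : b ≤ a generalizing a b
  · rw [abs_sub_comm, ← this b a (le_of_not_ge hab)]
    simp only [abs_sub_comm]
  have h (D : Fin m → K) : |(occCount B m a D : ℝ) - occCount B m b D|
      = occCount B m a D - occCount B m b D :=
    abs_of_nonneg (sub_nonneg.2 (by exact_mod_cast occCount_mono B m hab D))
  rw [abs_of_nonneg (sub_nonneg.2 (by exact_mod_cast hab))]
  simp only [h, Finset.sum_sub_distrib]
  exact_mod_cast congrArg₂ (fun x y : ℕ => (x : ℝ) - y) (sum_occCount B m a) (sum_occCount B m b)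

lemma one_le_sum_cylVec {K : Type*} [Fintype K] [MeasurableSpace K] (μ : Measure (ℕ → K))
    [IsProbabilityMeasure μ] (m : ℕ) : 1 ≤ ∑ D, cylVec μ m D := by
  have h : μ Set.univ ≤ ∑ D : Fin m → K, μ {z : ℕ → K | ∀ j : Fin m, z j.1 = D j} := by
    refine le_trans (measure_mono fun z _ => ?_) (measure_iUnion_fintype_le μ _)
    exact Set.mem_iUnion.2 ⟨fun j => z j.1, fun _ => rfl⟩
  rw [measure_univ] at h
  simp only [cylVec]
  rw [← ENNReal.toReal_sum fun D _ => measure_ne_top μ _]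
  simpa using ENNReal.toReal_mono (ENNReal.sum_ne_top.2 fun D _ => measure_ne_top μ _) h

/-- The total mass of the empirical measure differs from `1` by at most the distance to `μ`. -/
lemma abs_one_sub_mass_le_dm {K : Type*} [Fintype K] [DecidableEq K] [MeasurableSpace K]
    (μ : Measure (ℕ → K)) [IsProbabilityMeasure μ] (B : ℕ → K) (n m : ℕ) :
    |1 - (n : ℝ)⁻¹ * (n - m + 1 : ℕ)| ≤ dm m (empMeas B n m) (cylVec μ m) := by
  have hsum : ∑ D, empMeas B n m D = (n : ℝ)⁻¹ * (n - m + 1 : ℕ) := by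
    simp only [empMeas_eq_occCount, ← Finset.mul_sum]
    exact_mod_cast congrArg (fun x : ℕ => (n : ℝ)⁻¹ * (x : ℝ)) (sum_occCount B m (n - m + 1))
  have hd : |∑ D, cylVec μ m D - (n : ℝ)⁻¹ * (n - m + 1 : ℕ)|
      ≤ dm m (empMeas B n m) (cylVec μ m) := by
    rw [← hsum, abs_sub_comm, ← Finset.sum_sub_distrib]
    exact Finset.abs_sum_le_sum_abs _ _
  refine le_trans ?_ hd
  rcases Nat.eq_zero_or_pos m with rfl | hm
  · have : ∑ D, cylVec μ 0 D = 1 := by simp [cylVec]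
    rw [this]
  · have h1 := one_le_sum_cylVec μ m
    have h2 : (n : ℝ)⁻¹ * (n - m + 1 : ℕ) ≤ 1 := by
      rcases Nat.eq_zero_or_pos n with rfl | hn
      · simp
      · rw [inv_mul_le_one₀ (by exact_mod_cast hn)]
        exact_mod_cast (by omega : n - m + 1 ≤ n)
    rw [abs_of_nonneg (by linarith), abs_of_nonneg (by linarith)]
    linarith

/-- If `B` (of length `n`) and its prefix `B_{[1,l]}` are both
`(m,ε)`-generic for a shift-invariant probability measure `μ` and `l < n(1−√ε)`, then the
suffix `B_{[l+1,n]}` is `(m,3√ε)`-generic for `μ`. -/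
theorem stmt8 {K : Type*} [Fintype K] [DecidableEq K] [MeasurableSpace K]
    (μ : Measure (ℕ → K)) (hμp : IsProbabilityMeasure μ)
    (hμinv : MeasurePreserving (fun (x : ℕ → K) (n : ℕ) => x (n + 1)) μ μ)
    (B : ℕ → K) (n m l : ℕ) (hm : m ≤ n) (ε : ℝ) (hε : 0 < ε)
    (hl : (l : ℝ) < n * (1 - Real.sqrt ε))
    (hB : dm m (empMeas B n m) (cylVec μ m) < ε)
    (hprefix : dm m (empMeas B l m) (cylVec μ m) < ε) :
    dm m (empMeas (fun i => B (l + i)) (n - l) m) (cylVec μ m) < 3 * Real.sqrt ε := by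
  have hs0 : 0 < √ε := Real.sqrt_pos.2 hε
  have hss : √ε * √ε = ε := Real.mul_self_sqrt hε.le
  have hn : (0 : ℝ) < n := by
    rcases Nat.eq_zero_or_pos n with rfl | h
    · have : (0 : ℝ) ≤ l := Nat.cast_nonneg l
      norm_num at hl
      linarith
    · exact_mod_cast h
  have hs1 : √ε < 1 := by
    have : 0 < (n : ℝ) * (1 - √ε) := (Nat.cast_nonneg l).trans_lt hl
    linarith [(mul_pos_iff_of_pos_left hn).1 this]
  have hmassB := (abs_one_sub_mass_le_dm μ B n m).trans_lt hB
  have hmassP := (abs_one_sub_mass_le_dm μ B l m).trans_lt hprefix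
  have hln : (l : ℝ) < n := by nlinarith
  have hln' : l < n := by exact_mod_cast hln
  have hl0 : (0 : ℝ) < l := by
    rcases Nat.eq_zero_or_pos l with rfl | h
    · norm_num at hmassP
      nlinarith
    · exact_mod_cast h
  have hk : ((n - l : ℕ) : ℝ) = n - l := Nat.cast_sub hln'.le
  have hk' : (n : ℝ) * √ε < (n - l : ℕ) := by rw [hk]; linarith
  have hk0 : (0 : ℝ) < (n - l : ℕ) := (mul_pos hn hs0).trans hk'
  have hmk : m ≤ n - l := by
    by_contra! h
    have h1 : ((n - l : ℕ) : ℝ) + 1 ≤ m := by exact_mod_cast h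
    have h2 := (abs_lt.1 hmassB).2
    push_cast [Nat.cast_sub hm] at h2
    have h3 : (n : ℝ) * (1 - (n : ℝ)⁻¹ * (n - m + 1)) = m - 1 := by field_simp; ring
    have h4 := mul_lt_mul_of_pos_left h2 hn
    rw [h3] at h4
    nlinarith [mul_pos hn hs0]
  have hlen : n - m + 1 = l + (n - l - m + 1) := by omega
  set ν := cylVec μ m
  set L := l - m + 1
  have hcross : |(L : ℝ) - l| < l * ε := by
    have h := mul_lt_mul_of_pos_left hmassP hl0
    rw [← abs_of_pos hl0, ← abs_mul, abs_of_pos hl0] at h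
    rwa [show (l : ℝ) * (1 - (l : ℝ)⁻¹ * L) = l - L by field_simp, abs_sub_comm] at h
  have hpt (D : Fin m → K) :
      ((n - l : ℕ) : ℝ) * |empMeas (fun i => B (l + i)) (n - l) m D - ν D|
        ≤ n * |empMeas B n m D - ν D| + l * |empMeas B l m D - ν D|
          + |(occCount B m L D : ℝ) - occCount B m l D| := by
    have hid : ((n - l : ℕ) : ℝ) * (empMeas (fun i => B (l + i)) (n - l) m D - ν D)
        = n * (empMeas B n m D - ν D) - l * (empMeas B l m D - ν D)
          + ((occCount B m L D : ℝ) - occCount B m l D) := by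
      simp only [empMeas_eq_occCount, mul_sub, mul_inv_cancel_left₀ hk0.ne',
        mul_inv_cancel_left₀ hn.ne', mul_inv_cancel_left₀ hl0.ne']
      rw [hlen, occCount_add B m l (n - l - m + 1), hk]
      push_cast
      ring
    calc _ = |((n - l : ℕ) : ℝ) * (empMeas (fun i => B (l + i)) (n - l) m D - ν D)| := by
          rw [abs_mul, abs_of_pos hk0]
      _ ≤ _ := by
          rw [hid]
          refine (abs_add_le _ _).trans (add_le_add_left ((abs_sub _ _).trans_eq ?_) _)
          rw [abs_mul, abs_mul, abs_of_pos hn, abs_of_pos hl0]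
  have hsum : ((n - l : ℕ) : ℝ) * dm m (empMeas (fun i => B (l + i)) (n - l) m) ν
      ≤ n * dm m (empMeas B n m) ν + l * dm m (empMeas B l m) ν + |(L : ℝ) - l| := by
    rw [← sum_abs_occCount_sub B m L l]
    simp only [dm, Finset.mul_sum, ← Finset.sum_add_distrib]
    exact Finset.sum_le_sum fun D _ => hpt D
  refine lt_of_mul_lt_mul_left ?_ hk0.le
  have h1 := mul_lt_mul_of_pos_left hB hn
  have h2 := mul_lt_mul_of_pos_left hprefix hl0
  have h3 := mul_lt_mul_of_pos_right hln hε
  have h4 := mul_lt_mul_of_pos_right hk' hs0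
  rw [mul_assoc, hss] at h4
  linarith
end
end

section
/- Let m ≥ 1 and ε > 0. Let B, C be blocks over K of the same length, and B', C' blocks over K of the same length, all of length greater than m, such that d^{(m)}(μ_B, μ_C) < ε and d^{(m)}(μ_{B'}, μ_{C'}) < ε. If the joint length |B| + |B'| is at least 4m/ε, then the concatenations satisfy d^{(m)}(μ_{BB'}, μ_{CC'}) < 2ε. -/
open Filter Topology

noncomputable section

/-- The concatenation of a block `B` of length `nB` with a block `B'`. -/
def concatBlocks {K : Type*} (B B' : ℕ → K) (nB : ℕ) : ℕ → K :=
  fun i => if i < nB then B i else B' (i - nB)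

/-- The indicator that the block `D` occurs in `B` at position `i`. -/
def occursAt {K : Type*} [DecidableEq K] {m : ℕ} (B : ℕ → K) (i : ℕ) (D : Fin m → K) : ℝ :=
  if ∀ j : Fin m, B (i + j.1) = D j then 1 else 0

theorem occursAt_nonneg {K : Type*} [DecidableEq K] {m : ℕ} (B : ℕ → K) (i : ℕ)
    (D : Fin m → K) : 0 ≤ occursAt B i D := by
  unfold occursAt
  split_ifs <;> norm_num

theorem empMeas_eq_sum_occursAt {K : Type*} [DecidableEq K] (B : ℕ → K) (n m : ℕ)
    (D : Fin m → K) :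
    empMeas B n m D = (n : ℝ)⁻¹ * ∑ i ∈ Finset.range (n - m + 1), occursAt B i D := by
  simp [empMeas, occursAt]

theorem sum_occursAt {K : Type*} [Fintype K] [DecidableEq K] {m : ℕ} (B : ℕ → K) (i : ℕ) :
    ∑ D : Fin m → K, occursAt B i D = 1 := by
  simp [occursAt, ← funext_iff]

theorem mul_dm_empMeas {K : Type*} [Fintype K] [DecidableEq K] (B C : ℕ → K) {n : ℕ}
    (hn : 0 < n) (m : ℕ) :
    (n : ℝ) * dm m (empMeas B n m) (empMeas C n m) =
      ∑ D : Fin m → K, |∑ i ∈ Finset.range (n - m + 1), (occursAt B i D - occursAt C i D)| := by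
  have hn' : (0 : ℝ) < n := by exact_mod_cast hn
  simp only [dm, empMeas_eq_sum_occursAt, ← mul_sub, ← Finset.sum_sub_distrib, abs_mul,
    ← Finset.mul_sum, abs_inv, Nat.abs_cast]
  rw [mul_inv_cancel_left₀ hn'.ne']

theorem sum_abs_sum_occursAt_sub_le {K : Type*} [Fintype K] [DecidableEq K] {m : ℕ}
    (B C : ℕ → K) (s : ℕ → ℕ) (k : ℕ) :
    ∑ D : Fin m → K, |∑ i ∈ Finset.range k, (occursAt B (s i) D - occursAt C (s i) D)| ≤
      2 * k := by
  calc _ ≤ ∑ D : Fin m → K, ∑ i ∈ Finset.range k, (occursAt B (s i) D + occursAt C (s i) D) := by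
        gcongr with D
        refine (Finset.abs_sum_le_sum_abs _ _).trans ?_
        gcongr with i
        have hB := occursAt_nonneg B (s i) D
        have hC := occursAt_nonneg C (s i) D
        exact abs_le.2 ⟨by linarith, by linarith⟩
    _ = 2 * k := by
        rw [Finset.sum_comm]
        simp only [Finset.sum_add_distrib, sum_occursAt]
        simp
        ring

theorem occursAt_concatBlocks_left {K : Type*} [DecidableEq K] {m : ℕ} (B B' : ℕ → K)
    {n i : ℕ} (h : i + m ≤ n) (D : Fin m → K) :
    occursAt (concatBlocks B B' n) i D = occursAt B i D := by
  have (j : Fin m) : i + j.1 < n := by omega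
  simp [occursAt, concatBlocks, this]

theorem occursAt_concatBlocks_right {K : Type*} [DecidableEq K] {m : ℕ} (B B' : ℕ → K)
    (n i : ℕ) (D : Fin m → K) :
    occursAt (concatBlocks B B' n) (n + i) D = occursAt B' i D := by
  simp [occursAt, concatBlocks, add_assoc]

/-- If `d^{(m)}(μ_B, μ_C) < ε` and `d^{(m)}(μ_{B'}, μ_{C'}) < ε`, where
`|B| = |C|`, `|B'| = |C'|`, all lengths exceed `m`, and the joint length `|B| + |B'|` is at
least `4m/ε`, then `d^{(m)}(μ_{BB'}, μ_{CC'}) < 2ε`. -/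
theorem stmt10 {K : Type*} [Fintype K] [DecidableEq K]
    (m : ℕ) (hm : 1 ≤ m) (ε : ℝ) (hε : 0 < ε)
    (B C B' C' : ℕ → K) (nB nB' : ℕ) (hnB : m < nB) (hnB' : m < nB')
    (h1 : dm m (empMeas B nB m) (empMeas C nB m) < ε)
    (h2 : dm m (empMeas B' nB' m) (empMeas C' nB' m) < ε)
    (hlen : 4 * (m : ℝ) / ε ≤ (nB : ℝ) + (nB' : ℝ)) :
    dm m (empMeas (concatBlocks B B' nB) (nB + nB') m)
      (empMeas (concatBlocks C C' nB) (nB + nB') m) < 2 * ε := by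
  have hB : (0 : ℝ) < nB := by exact_mod_cast (Nat.zero_lt_of_lt hnB)
  have hB' : (0 : ℝ) < nB' := by exact_mod_cast (Nat.zero_lt_of_lt hnB')
  have h1' := mul_lt_mul_of_pos_left h1 hB
  have h2' := mul_lt_mul_of_pos_left h2 hB'
  rw [mul_dm_empMeas B C (by omega)] at h1'
  rw [mul_dm_empMeas B' C' (by omega)] at h2'
  rw [div_le_iff₀ hε] at hlen
  have hmid := sum_abs_sum_occursAt_sub_le (m := m) (concatBlocks B B' nB) (concatBlocks C C' nB)
    (fun i => nB - m + 1 + i) (m - 1)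
  have hm' : ((m - 1 : ℕ) : ℝ) ≤ m := by exact_mod_cast Nat.sub_le m 1
  have key := mul_dm_empMeas (concatBlocks B B' nB) (concatBlocks C C' nB)
    (n := nB + nB') (by omega) m
  have hsplit : nB + nB' - m + 1 = (nB - m + 1) + (m - 1) + (nB' - m + 1) := by omega
  have hstart : nB - m + 1 + (m - 1) = nB := by omega
  have hle : ((nB + nB' : ℕ) : ℝ) * dm m (empMeas (concatBlocks B B' nB) (nB + nB') m)
      (empMeas (concatBlocks C C' nB) (nB + nB') m) ≤
      (∑ D : Fin m → K,
        |∑ i ∈ Finset.range (nB - m + 1), (occursAt B i D - occursAt C i D)|) +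
      (∑ D : Fin m → K, |∑ i ∈ Finset.range (m - 1),
        (occursAt (concatBlocks B B' nB) (nB - m + 1 + i) D -
          occursAt (concatBlocks C C' nB) (nB - m + 1 + i) D)|) +
      ∑ D : Fin m → K,
        |∑ i ∈ Finset.range (nB' - m + 1), (occursAt B' i D - occursAt C' i D)| := by
    rw [key, hsplit, ← Finset.sum_add_distrib, ← Finset.sum_add_distrib]
    gcongr with D
    rw [Finset.sum_range_add, Finset.sum_range_add, hstart]
    simp only [occursAt_concatBlocks_right]
    have hleft : ∑ i ∈ Finset.range (nB - m + 1),
        (occursAt (concatBlocks B B' nB) i D - occursAt (concatBlocks C C' nB) i D) =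
        ∑ i ∈ Finset.range (nB - m + 1), (occursAt B i D - occursAt C i D) := by
      refine Finset.sum_congr rfl fun i hi => ?_
      have hi' : i + m ≤ nB := by
        have := Finset.mem_range.1 hi
        omega
      rw [occursAt_concatBlocks_left B B' hi', occursAt_concatBlocks_left C C' hi']
    rw [hleft]
    exact abs_add_three _ _ _
  have hpos : (0 : ℝ) < nB + nB' := by positivity
  push_cast at hle
  refine lt_of_mul_lt_mul_left (a := (nB : ℝ) + nB') ?_ hpos.le
  nlinarith
end
end

section
/- Let α be irrational and let φ : S¹ → {−1,1} be a measurable cocycle over the rotation by α. If there exists a sequence (n_k) of positive integers such that n_k·α → 0 in S¹ and the n_k-step cocycles φ^{(n_k)} do not converge to the constant function 1 in L¹(ds), then the cocycle φ is ergodic. -/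
open MeasureTheory Filter Topology

noncomputable section

/-- The skew product `T_φ(s,κ) = (s+α, κ·φ(s))` on `S¹ × {−1,1}`, where `{−1,1}` is
modelled as `ℤˣ`. -/
def skewProd (α : ℝ) (φ : UnitAddCircle → ℤˣ) :
    UnitAddCircle × ℤˣ → UnitAddCircle × ℤˣ :=
  fun p => (p.1 + (α : UnitAddCircle), p.2 * φ p.1)

/-- The uniform (Haar) probability measure on `{−1,1} = ℤˣ`. -/
def uniformZ2 : Measure ℤˣ := (2 : ENNReal)⁻¹ • Measure.count

/-- The product of the Haar (Lebesgue) probability measure on `S¹` with the uniform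
measure on `{−1,1}`. -/
def prodMeas : Measure (UnitAddCircle × ℤˣ) := (volume : Measure UnitAddCircle).prod uniformZ2

/-- The `n`-step cocycle `φ^{(n)}(s) = Π_{j=0}^{n−1} φ(s + jα)`. -/
def stepCocycle (α : ℝ) (φ : UnitAddCircle → ℤˣ) (n : ℕ) (s : UnitAddCircle) : ℤˣ :=
  ∏ j ∈ Finset.range n, φ (s + (((j : ℝ) * α : ℝ) : UnitAddCircle))

instance : DiscreteMeasurableSpace ℤˣ where
  forall_measurableSet s := ⟨Units.val '' s, MeasurableSet.of_discrete,
    Set.preimage_image_eq s Units.val_injective⟩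

instance : IsProbabilityMeasure uniformZ2 where
  measure_univ := by
    simp only [uniformZ2, Measure.smul_apply, smul_eq_mul, Measure.count_univ]
    rw [ENat.card_eq_coe_fintype_card, Fintype.card_units_int]
    exact ENNReal.inv_mul_cancel (by simp) (by simp)

theorem measurePreserving_mul_uniformZ2 (u : ℤˣ) :
    MeasurePreserving (fun κ : ℤˣ => κ * u) uniformZ2 uniformZ2 := by
  refine ⟨Measurable.of_discrete, ?_⟩
  ext s hs
  rw [Measure.map_apply Measurable.of_discrete hs]
  simp only [uniformZ2, Measure.smul_apply]
  congr 1
  rw [Measure.count_apply (Set.toFinite _).measurableSet, Measure.count_apply hs]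
  exact congrArg _ (Set.encard_preimage_of_bijective (Group.mulRight_bijective u) s)

theorem measurePreserving_skewProd (α : ℝ) {φ : UnitAddCircle → ℤˣ} (hφ : Measurable φ) :
    MeasurePreserving (skewProd α φ) prodMeas prodMeas := by
  refine (measurePreserving_add_right volume (α : UnitAddCircle)).skew_product
    (g := fun s κ => κ * φ s) ?_ ?_
  · exact (Measurable.of_discrete (f := fun p : ℤˣ × ℤˣ => p.1 * p.2)).comp
      (measurable_snd.prodMk (hφ.comp measurable_fst))
  · exact Eventually.of_forall fun s => (measurePreserving_mul_uniformZ2 (φ s)).map_eq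

theorem ergodic_add_irrational {α : ℝ} (hα : Irrational α) :
    Ergodic (fun s : UnitAddCircle => s + (α : UnitAddCircle)) := by
  rw [AddCircle.ergodic_add_right, addOrderOf_eq_zero_iff,
    AddCircle.not_isOfFinAddOrder_iff_forall_rat_ne_div]
  rintro q hq
  exact hα ⟨q, by simpa using hq⟩

theorem mem_skewProd_iterate_iff {α : ℝ} {φ : UnitAddCircle → ℤˣ}
    {A : Set (UnitAddCircle × ℤˣ)} (hA : skewProd α φ ⁻¹' A = A) (n : ℕ)
    (s : UnitAddCircle) (κ : ℤˣ) :
    (s + ((n * α : ℝ) : UnitAddCircle), κ * stepCocycle α φ n s) ∈ A ↔ (s, κ) ∈ A := by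
  induction n with
  | zero => simp [stepCocycle]
  | succ n ih =>
    rw [← ih]
    conv_rhs => rw [← hA]
    simp only [Set.mem_preimage, skewProd, stepCocycle, Finset.prod_range_succ, mul_assoc,
      add_assoc, ← AddCircle.coe_add, Nat.cast_succ, add_mul, one_mul]

theorem tendsto_measureReal_symmDiff_translate {P : Set UnitAddCircle} (hP : MeasurableSet P)
    {t : ℕ → UnitAddCircle} (ht : Tendsto t atTop (𝓝 0)) :
    Tendsto (fun k => volume.real (symmDiff ((fun s => s + t k) ⁻¹' P) P)) atTop (𝓝 0) := by
  let F : C(UnitAddCircle, C(UnitAddCircle, UnitAddCircle)) :=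
    ContinuousMap.curry ⟨fun p => p.2 + p.1, by fun_prop⟩
  have h := tendsto_measure_symmDiff_preimage_nhds_zero (μ := volume) (ν := volume) (s := P)
    (f := fun k => F (t k)) ((F.continuous.tendsto 0).comp ht)
    (Eventually.of_forall fun k => measurePreserving_add_right volume (t k))
    (measurePreserving_add_right volume 0) hP.nullMeasurableSet (measure_ne_top _ _)
  have hreal := (ENNReal.tendsto_toReal ENNReal.zero_ne_top).comp h
  have h0 : ⇑(F 0) ⁻¹' P = P := by
    ext s; simp [F]
  simp only [h0, ENNReal.toReal_zero] at hreal
  exact hreal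

/-- If almost every fibre of an invariant set is a single point, then the step cocycles tend
to `1` along rigidity times of the rotation. -/
theorem tendsto_integral_stepCocycle_sub_one {α : ℝ} {φ : UnitAddCircle → ℤˣ}
    {A : Set (UnitAddCircle × ℤˣ)} (hAm : MeasurableSet A) (hA : skewProd α φ ⁻¹' A = A)
    (hfib : ∀ᵐ s : UnitAddCircle, (s, (-1 : ℤˣ)) ∈ A ↔ (s, (1 : ℤˣ)) ∉ A) {nk : ℕ → ℕ}
    (hconv : Tendsto (fun k : ℕ => (((nk k : ℝ) * α : ℝ) : UnitAddCircle)) atTop (𝓝 0)) :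
    Tendsto (fun k : ℕ => ∫ s : UnitAddCircle,
      |((stepCocycle α φ (nk k) s : ℤ) : ℝ) - 1| ∂volume) atTop (𝓝 0) := by
  have hP : MeasurableSet {s : UnitAddCircle | (s, (1 : ℤˣ)) ∈ A} :=
    measurable_prodMk_right hAm
  set P := {s : UnitAddCircle | (s, (1 : ℤˣ)) ∈ A}
  have hlim := (tendsto_measureReal_symmDiff_translate hP hconv).mul_const 2
  rw [zero_mul] at hlim
  refine squeeze_zero (fun k => integral_nonneg fun s => abs_nonneg _) (fun k => ?_) hlim
  have hQ := ((measurable_add_const (((nk k : ℝ) * α : ℝ) : UnitAddCircle)) hP).symmDiff hP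
  rw [← smul_eq_mul, ← integral_indicator_const (2 : ℝ) hQ]
  refine integral_mono_of_nonneg (Eventually.of_forall fun s => abs_nonneg _)
    ((integrable_const _).indicator hQ) ?_
  filter_upwards [hfib] with s hs
  rcases Int.units_eq_one_or (stepCocycle α φ (nk k) s) with h | h
  · rw [h]
    simpa using Set.indicator_nonneg (fun _ _ => zero_le_two) s
  · have h1 := mem_skewProd_iterate_iff hA (nk k) s (-1)
    rw [h, neg_one_mul, neg_neg, hs] at h1
    rw [Set.indicator_of_mem, h]
    · norm_num
    · rw [Set.mem_symmDiff]
      change ((_ + _, (1 : ℤˣ)) ∈ A ∧ (s, (1 : ℤˣ)) ∉ A) ∨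
        ((s, (1 : ℤˣ)) ∈ A ∧ (_ + _, (1 : ℤˣ)) ∉ A)
      tauto

/-- If there is a sequence `(n_k)` of positive integers with
`n_k·α → 0` in `S¹` and `φ^{(n_k)} ↛ 1` in `L¹(ds)`, then the cocycle `φ` is ergodic. -/
theorem stmt14 (α : ℝ) (hα : Irrational α)
    (φ : UnitAddCircle → ℤˣ) (hφ : Measurable φ)
    (nk : ℕ → ℕ) (hpos : ∀ k, 0 < nk k)
    (hconv : Tendsto (fun k : ℕ => (((nk k : ℝ) * α : ℝ) : UnitAddCircle)) atTop (𝓝 0))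
    (hnotL1 : ¬ Tendsto
      (fun k : ℕ => ∫ s : UnitAddCircle,
        |((stepCocycle α φ (nk k) s : ℤ) : ℝ) - 1| ∂volume) atTop (𝓝 0)) :
    Ergodic (skewProd α φ) prodMeas := by
  have hrot := (ergodic_add_irrational hα).toPreErgodic
  refine { toMeasurePreserving := measurePreserving_skewProd α hφ, aeconst_set := ?_ }
  intro A hAm hA
  have lift {q : UnitAddCircle → Prop} (hq : ∀ᵐ s, q s) : ∀ᵐ p ∂prodMeas, q p.1 :=
    Measure.quasiMeasurePreserving_fst.ae hq
  have hinv (s : UnitAddCircle) (κ : ℤˣ) :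
      (s + (α : UnitAddCircle), κ * φ s) ∈ A ↔ (s, κ) ∈ A := Set.ext_iff.1 hA (s, κ)
  have hsec (κ : ℤˣ) : MeasurableSet {s : UnitAddCircle | (s, κ) ∈ A} :=
    measurable_prodMk_right hAm
  have hstep (s : UnitAddCircle) :
      ((s + (α : UnitAddCircle), (1 : ℤˣ)) ∈ A ↔ (s, φ s) ∈ A) ∧
        ((s + (α : UnitAddCircle), (-1 : ℤˣ)) ∈ A ↔ (s, -φ s) ∈ A) := by
    refine ⟨?_, ?_⟩
    · rw [← hinv s (φ s), Int.units_mul_self]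
    · rw [← hinv s (-φ s), neg_mul, Int.units_mul_self]
  have hU := hrot.ae_mem_or_ae_notMem ((hsec 1).union (hsec (-1))) (by
    ext s
    have := hstep s
    rcases Int.units_eq_one_or (φ s) with h | h <;>
      simp only [h, neg_neg] at this <;>
      simp only [Set.mem_preimage, Set.mem_union, Set.mem_ofPred_eq] <;> tauto)
  have hD := hrot.ae_mem_or_ae_notMem ((hsec 1).inter (hsec (-1))) (by
    ext s
    have := hstep s
    rcases Int.units_eq_one_or (φ s) with h | h <;>
      simp only [h, neg_neg] at this <;>
      simp only [Set.mem_preimage, Set.mem_inter_iff, Set.mem_ofPred_eq] <;> tauto)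
  rw [eventuallyConst_set]
  rcases hU with hU | hU
  · rcases hD with hD | hD
    · left
      filter_upwards [lift hD] with ⟨s, κ⟩ hs
      rcases Int.units_eq_one_or κ with rfl | rfl
      exacts [hs.1, hs.2]
    · refine absurd (tendsto_integral_stepCocycle_sub_one hAm hA ?_ hconv) hnotL1
      filter_upwards [hU, hD] with s h₁ h₂
      simp only [Set.mem_union, Set.mem_inter_iff, Set.mem_ofPred_eq] at h₁ h₂
      tauto
  · right
    filter_upwards [lift hU] with ⟨s, κ⟩ hs hmem
    rcases Int.units_eq_one_or κ with rfl | rfl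
    exacts [hs (Or.inl hmem), hs (Or.inr hmem)]
end
end
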